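/- arXiv:0809.4519 — 7 statements merged into one kernel-verified Lean document; each statement's English description precedes it below -/
import Mathlib

section
/- Let U be a unitary representation of the additive group ℝ^n on a separable complex Hilbert space H having no nonzero invariant vectors (i.e., if U_t x = x for all t ∈ ℝ^n then x = 0). Let p : ℝ → ℝ^n be a polynomial curve, considered on the interval [0,1], whose image p([0,1]) is not contained in any proper affine subspace of ℝ^n. For x ∈ H and λ > 0 define the Bochner integral x_λ = ∫₀¹ U_{λ p(t)} x dt. Then ‖x_λ‖ → 0 as λ → ∞. -/
open MeasureTheory Filter

/-- The zero set of a nonzero real multivariate polynomial is Lebesgue-null. -/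
lemma MvPolynomial.volume_setOf_eval_eq_zero : ∀ {n : ℕ} (D : MvPolynomial (Fin n) ℝ), D ≠ 0 →
    volume {t : Fin n → ℝ | MvPolynomial.eval t D = 0} = 0 := by
  intro n
  induction n with
  | zero =>
    intro D hD
    convert! measure_empty (μ := (volume : Measure (Fin 0 → ℝ)))
    ext t
    simp only [Set.mem_ofPred_eq, Set.mem_empty_iff_false, iff_false]
    intro h
    apply hD
    apply MvPolynomial.funext
    intro s
    rw [Subsingleton.elim s t, h, map_zero]
  | succ n ih =>
    intro D hD
    have hmeas : MeasurableSet {t : Fin (n + 1) → ℝ | MvPolynomial.eval t D = 0} :=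
      (isClosed_eq (MvPolynomial.continuous_eval D) continuous_const).measurableSet
    have hmp := (volume_preserving_piFinSuccAbove (fun _ : Fin (n + 1) => ℝ) 0).symm
    rw [← hmp.measure_preimage hmeas.nullMeasurableSet]
    have hswap := (Measure.measurePreserving_swap
      (μ := (volume : Measure (Fin n → ℝ))) (ν := (volume : Measure ℝ)))
    rw [Measure.volume_eq_prod, ← hswap.measure_preimage
      (hmp.measurable hmeas).nullMeasurableSet]
    rw [Measure.measure_prod_null (hswap.measurable (hmp.measurable hmeas))]
    have hQ : MvPolynomial.finSuccEquiv ℝ n D ≠ 0 := by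
      simpa using hD
    obtain ⟨k, hk⟩ : ∃ k, (MvPolynomial.finSuccEquiv ℝ n D).coeff k ≠ 0 := by
      by_contra! h
      exact hQ (Polynomial.ext (by simpa using h))
    have := ih _ hk
    rw [measure_eq_zero_iff_ae_notMem] at this
    filter_upwards [this] with s hs
    set R := (MvPolynomial.finSuccEquiv ℝ n D).map (MvPolynomial.eval s) with hR
    have hR0 : R ≠ 0 := by
      intro h
      apply hs
      have := congrArg (fun r => Polynomial.coeff r k) h
      simpa [hR, Polynomial.coeff_map] using this
    refine measure_mono_null ?_ (R.roots.toFinset.finite_toSet.measure_zero volume)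
    intro y hy
    simp only [Set.mem_preimage, Set.mem_ofPred_eq, MeasurableEquiv.piFinSuccAbove_symm_apply,
      Prod.swap] at hy
    simp only [Finset.mem_coe, Multiset.mem_toFinset, Polynomial.mem_roots hR0,
      Polynomial.IsRoot.def]
    rw [hR, ← MvPolynomial.eval_eq_eval_mv_eval']
    simpa [Fin.insertNthEquiv] using hy

lemma exists_det_ne_zero {n : ℕ} (f : ℝ → Fin n → ℝ)
    (hf : ∀ ν : Fin n → ℝ, (∀ t, ∑ i, ν i * f t i = 0) → ν = 0) :
    ∃ t : Fin n → ℝ, (Matrix.of fun i j => f (t j) i).det ≠ 0 := by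
  have hspan : Submodule.span ℝ (Set.range f) = ⊤ := by
    by_contra h
    obtain ⟨φ, hφ, hle⟩ := Submodule.exists_le_ker_of_lt_top _ (lt_top_iff_ne_top.2 h)
    apply hφ
    have hφs : ∀ v, φ v = ∑ i, φ (Pi.single i 1) * v i := by
      intro v
      conv_lhs => rw [pi_eq_sum_univ' v]
      simp [mul_comm]
    have := hf (fun i => φ (Pi.single i 1)) fun t => by
      rw [← hφs]
      exact hle (Submodule.subset_span ⟨t, rfl⟩)
    ext i
    simpa using congrFun this i
  obtain ⟨b, hb, hbs, hli⟩ := exists_linearIndependent ℝ (Set.range f)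
  rw [hspan] at hbs
  let B : Module.Basis b ℝ (Fin n → ℝ) := Module.Basis.mk hli (by simp [hbs])
  have : Fintype b := FiniteDimensional.fintypeBasisIndex B
  have hc : Fintype.card b = n := by
    rw [← Module.finrank_eq_card_basis B]; simp
  let e : Fin n ≃ b := (Fintype.equivFinOfCardEq hc).symm
  choose t ht using fun j => hb (e j).2
  refine ⟨t, ?_⟩
  have hli' : LinearIndependent ℝ (fun j => f (t j)) := by
    simp_rw [ht]
    exact hli.comp e e.injective
  have := Matrix.linearIndependent_cols_iff_isUnit (A := (Matrix.of fun i j => f (t j) i))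
  rw [Matrix.isUnit_iff_isUnit_det] at this
  exact (this.1 (by simpa [Matrix.col_def] using! hli')).ne_zero

lemma HasStrictFDerivAt.exists_isOpen_injOn {E : Type*} [NormedAddCommGroup E] [NormedSpace ℝ E]
    [FiniteDimensional ℝ E] {q : E → E} {q' : E →L[ℝ] E} {x : E}
    (hq : HasStrictFDerivAt q q' x) (hx : q'.det ≠ 0) :
    (∃ u, IsOpen u ∧ x ∈ u ∧ Set.InjOn q u) ∧ map q (nhds x) = nhds (q x) := by
  have := FiniteDimensional.complete ℝ E
  have h : HasStrictFDerivAt q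
      (q'.toContinuousLinearEquivOfDetNeZero hx : E →L[ℝ] E) x := by
    rwa [ContinuousLinearMap.coe_toContinuousLinearEquivOfDetNeZero]
  refine ⟨⟨(h.toOpenPartialHomeomorph q).source, (h.toOpenPartialHomeomorph q).open_source,
    h.mem_toOpenPartialHomeomorph_source, ?_⟩, h.map_nhds_eq_of_equiv⟩
  exact (h.toOpenPartialHomeomorph q).injOn

/-- A strictly differentiable map whose Jacobian is almost everywhere nonzero pulls null sets back
to null sets. -/
lemma quasiMeasurePreserving_of_ae_det_ne_zero {E : Type*} [NormedAddCommGroup E]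
    [NormedSpace ℝ E] [FiniteDimensional ℝ E] [MeasurableSpace E] [BorelSpace E]
    (μ : Measure E) [μ.IsAddHaarMeasure] {q : E → E} {q' : E → E →L[ℝ] E}
    (hq : ∀ x, HasStrictFDerivAt q (q' x) x) (hdet : ∀ᵐ x ∂μ, (q' x).det ≠ 0) :
    Measure.QuasiMeasurePreserving q μ μ := by
  have hqc : Continuous q := continuous_iff_continuousAt.2 fun x => (hq x).continuousAt
  refine ⟨hqc.measurable, Measure.AbsolutelyContinuous.mk fun N hN hN0 => ?_⟩
  rw [Measure.map_apply hqc.measurable hN]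
  have hsub : q ⁻¹' N ⊆ {x | (q' x).det ≠ 0}ᶜ ∪ (q ⁻¹' N ∩ {x | (q' x).det ≠ 0}) := by
    intro x hx
    by_cases h : (q' x).det = 0 <;> simp_all
  refine measure_mono_null hsub (measure_union_null hdet ?_)
  apply measure_null_of_locally_null
  rintro x ⟨-, hx⟩
  obtain ⟨u, hu, hxu, hinj⟩ := ((hq x).exists_isOpen_injOn hx).1
  refine ⟨u ∩ (q ⁻¹' N ∩ {x | (q' x).det ≠ 0}),
    Filter.inter_mem (mem_nhdsWithin_of_mem_nhds (hu.mem_nhds hxu)) self_mem_nhdsWithin, ?_⟩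
  have hcv := lintegral_image_eq_lintegral_abs_det_fderiv_mul μ (hu.measurableSet.inter
      (hqc.measurable hN))
    (fun y _ => (hq y).hasFDerivAt.hasFDerivWithinAt) (hinj.mono Set.inter_subset_left) 1
  simp only [Pi.one_apply, lintegral_const, mul_one, one_mul] at hcv
  rw [Measure.restrict_apply_univ, measure_mono_null (t := N) _ hN0] at hcv
  rotate_left
  · rintro _ ⟨y, hy, rfl⟩
    exact hy.2
  · have hms := hu.measurableSet.inter (hqc.measurable hN)
    have hae := (setLIntegral_eq_zero_iff' hms (aemeasurable_ofReal_abs_det_fderivWithin μ hms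
      fun y _ => (hq y).hasFDerivAt.hasFDerivWithinAt)).1 hcv.symm
    refine measure_mono_null ?_ hae
    rintro y ⟨hyu, hyN, hy⟩ h
    have := h ⟨hyu, hyN⟩
    rw [ENNReal.ofReal_eq_zero] at this
    exact hy (abs_nonpos_iff.1 this)

section
variable {H : Type*} [NormedAddCommGroup H] [InnerProductSpace ℂ H]

lemma aestronglyMeasurable_linearIsometry_apply {α β : Type*} [MeasurableSpace α]
    [MeasurableSpace β] {μ : Measure α} {ν : Measure β} [SFinite μ] [SFinite ν]
    {W : α → H →ₗᵢ[ℂ] H} (hW : ∀ y, AEStronglyMeasurable (fun a => W a y) μ)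
    {g : β → H} (hg : AEStronglyMeasurable g ν) :
    AEStronglyMeasurable (fun z : α × β => W z.1 (g z.2)) (μ.prod ν) := by
  obtain ⟨g', hg', hgg'⟩ := hg
  have key : ∀ φ : SimpleFunc β H,
      AEStronglyMeasurable (fun z : α × β => W z.1 (φ z.2)) (μ.prod ν) := by
    intro φ
    induction φ using SimpleFunc.induction with
    | const c hs =>
      rename_i s
      have : (fun z : α × β => W z.1 ((SimpleFunc.piecewise s hs (SimpleFunc.const β c)
          (SimpleFunc.const β 0)) z.2)) =
          (Prod.snd ⁻¹' s).indicator (fun z : α × β => W z.1 c) := by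
        ext z
        by_cases hz : z.2 ∈ s <;> simp [hz]
      rw [this]
      exact (hW c).comp_fst.indicator (measurable_snd hs)
    | add _ hf hg =>
      simp only [SimpleFunc.coe_add, Pi.add_apply, map_add]
      exact hf.add hg
  have h1 : AEStronglyMeasurable (fun z : α × β => W z.1 (g' z.2)) (μ.prod ν) := by
    refine aestronglyMeasurable_of_tendsto_ae atTop (fun m => key (hg'.approx m))
      (Eventually.of_forall fun z => ?_)
    exact ((W z.1).continuous.tendsto _).comp (hg'.tendsto_approx z.2)
  refine h1.congr ?_
  filter_upwards [Measure.quasiMeasurePreserving_snd.ae_eq hgg'] with z hz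
  simp only [Function.comp_apply] at hz
  rw [hz]

lemma exists_clm_eq_integral {α : Type*} [MeasurableSpace α] {μ : Measure α} [IsFiniteMeasure μ]
    {W : α → H →ₗᵢ[ℂ] H} (hW : ∀ y, AEStronglyMeasurable (fun a => W a y) μ) :
    ∃ T : H →L[ℂ] H, ∀ y, T y = ∫ a, W a y ∂μ := by
  have hint : ∀ y, Integrable (fun a => W a y) μ := fun y =>
    Integrable.of_bound (hW y) ‖y‖ (by simp)
  refine ⟨LinearMap.mkContinuous
    { toFun := fun y => ∫ a, W a y ∂μ
      map_add' := fun y z => by simp [integral_add (hint y) (hint z)]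
      map_smul' := fun c y => by simp [integral_smul] } (μ.real Set.univ) fun y => ?_, fun y => rfl⟩
  refine (norm_integral_le_of_norm_le_const (C := ‖y‖) (by simp)).trans (by simp [mul_comm])

variable {V : Type*} [AddCommGroup V] {U : V → H →ₗᵢ[ℂ] H}

/-- Powers of the averaging operator `T = ∫ U (v a)` are averages over product spaces. -/
lemma integral_pi_sum_eq_pow [CompleteSpace H] {α : Type*} [MeasurableSpace α] {μ : Measure α} [IsFiniteMeasure μ]
    (hU : ∀ s t x, U (s + t) x = U s (U t x)) (hU0 : ∀ x, U 0 x = x) {v : α → V}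
    (hv : ∀ y, AEStronglyMeasurable (fun a => U (v a) y) μ)
    {T : H →L[ℂ] H} (hT : ∀ y, T y = ∫ a, U (v a) y ∂μ) (k : ℕ) (y : H) :
    AEStronglyMeasurable (fun t : Fin k → α => U (∑ i, v (t i)) y) (Measure.pi fun _ => μ) ∧
    ∫ t : Fin k → α, U (∑ i, v (t i)) y ∂(Measure.pi fun _ => μ) = (T ^ k) y := by
  induction k with
  | zero => simp [hU0, integral_const, measureReal_def]
  | succ k ih =>
    have hmp := measurePreserving_piFinSuccAbove (fun _ : Fin (k + 1) => μ) 0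
    have hj := aestronglyMeasurable_linearIsometry_apply hv ih.1
    have heq : (fun t : Fin (k + 1) → α => U (∑ i, v (t i)) y) =
        (fun z : α × (Fin k → α) => U (v z.1) (U (∑ i, v (z.2 i)) y)) ∘
          MeasurableEquiv.piFinSuccAbove (fun _ => α) 0 := by
      ext t
      simp [Fin.sum_univ_succ, hU, MeasurableEquiv.piFinSuccAbove, Fin.insertNthEquiv, Fin.tail]
    constructor
    · rw [heq]
      exact hj.comp_measurePreserving hmp
    · have hbd : Integrable (fun z : α × (Fin k → α) => U (v z.1) (U (∑ i, v (z.2 i)) y))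
          (μ.prod (Measure.pi fun _ => μ)) := Integrable.of_bound hj ‖y‖ (by simp)
      rw [heq]
      simp only [Function.comp_def]
      rw [hmp.integral_comp' (g := fun z : α × (Fin k → α) => U (v z.1) (U (∑ i, v (z.2 i)) y)),
        integral_prod _ hbd, pow_succ', mul_apply_eq_comp, ← ih.2, hT]
      congr 1
      ext a
      exact (U (v a)).toContinuousLinearMap.integral_comp_comm
        (Integrable.of_bound ih.1 ‖y‖ (by simp))

lemma inner_apply_eq_inner_neg (hU : ∀ s t x, U (s + t) x = U s (U t x)) (hU0 : ∀ x, U 0 x = x)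
    (s : V) (x y : H) : inner ℂ (U s x) y = inner ℂ x (U (-s) y) := by
  rw [← (U (-s)).inner_map_map, ← hU, neg_add_cancel, hU0]

/-- The averaging operator is normal, hence paranormal. -/
lemma norm_sq_le_of_eq_integral [CompleteSpace H] {α : Type*} [MeasurableSpace α] {μ : Measure α} [IsFiniteMeasure μ]
    (hU : ∀ s t x, U (s + t) x = U s (U t x)) (hU0 : ∀ x, U 0 x = x) {v : α → V}
    (hv : ∀ y, AEStronglyMeasurable (fun a => U (v a) y) μ)
    {T : H →L[ℂ] H} (hT : ∀ y, T y = ∫ a, U (v a) y ∂μ) (y : H) :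
    ‖T y‖ ^ 2 ≤ ‖T (T y)‖ * ‖y‖ := by
  have hint : ∀ y, Integrable (fun a => U (v a) y) μ := fun y =>
    Integrable.of_bound (hv y) ‖y‖ (by simp)
  have hcomm : ∀ s y, T (U s y) = U s (T y) := by
    intro s y
    rw [hT, hT]
    refine Eq.trans ?_ ((U s).toContinuousLinearMap.integral_comp_comm (hint y))
    congr 1
    ext a
    simp [← hU, add_comm]
  have hcomm' : ∀ s y, T.adjoint (U s y) = U s (T.adjoint y) := by
    intro s y
    refine ext_inner_right ℂ fun z => ?_
    rw [ContinuousLinearMap.adjoint_inner_left, inner_apply_eq_inner_neg hU hU0, ← hcomm,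
      inner_apply_eq_inner_neg hU hU0 s, ContinuousLinearMap.adjoint_inner_left]
  have hnormal : ∀ y, T (T.adjoint y) = T.adjoint (T y) := by
    intro y
    rw [hT, hT, ← T.adjoint.integral_comp_comm (hint y)]
    simp_rw [hcomm']
  have hstar : ‖T.adjoint (T y)‖ = ‖T (T y)‖ := by
    have hs : IsStarNormal T := ⟨by
      ext z
      simp [ContinuousLinearMap.star_eq_adjoint, hnormal]⟩
    exact (ContinuousLinearMap.isStarNormal_iff_norm_eq_adjoint.1 hs (T y)).symm
  calc ‖T y‖ ^ 2 = ‖inner ℂ (T y) (T y)‖ := by simp [inner_self_eq_norm_sq_to_K]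
    _ = ‖inner ℂ (T.adjoint (T y)) y‖ := by rw [ContinuousLinearMap.adjoint_inner_left]
    _ ≤ ‖T.adjoint (T y)‖ * ‖y‖ := norm_inner_le_norm _ _
    _ = _ := by rw [hstar]

lemma tendsto_apply_zero_of_tendsto_pow {ι : Type*} {l : Filter ι} {T : ι → H →L[ℂ] H}
    (hT : ∀ᶠ i in l, ∀ y, ‖T i y‖ ^ 2 ≤ ‖T i (T i y)‖ * ‖y‖)
    (hT1 : ∀ᶠ i in l, ∀ y, ‖T i y‖ ≤ ‖y‖) (y : H) (k : ℕ)
    (h : Tendsto (fun i => ‖(T i ^ k) y‖) l (nhds 0)) : Tendsto (fun i => ‖T i y‖) l (nhds 0) := by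
  have hpow : ∀ k, ∀ᶠ i in l, ‖(T i ^ k) y‖ ≤ ‖y‖ := by
    intro k
    filter_upwards [hT1] with i hi
    induction k with
    | zero => simp
    | succ k ih =>
      rw [pow_succ']
      exact (hi _).trans ih
  have h' : Tendsto (fun i => ‖(T i ^ (k + 1)) y‖) l (nhds 0) := by
    refine squeeze_zero' (Eventually.of_forall fun _ => norm_nonneg _) ?_ h
    filter_upwards [hT1] with i hi
    rw [pow_succ']
    exact hi _
  clear h
  induction k with
  | zero => simpa using h'
  | succ k ih =>
    apply ih
    have h2 : Tendsto (fun i => √(‖(T i ^ (k + 1 + 1)) y‖ * ‖y‖)) l (nhds 0) := by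
      simpa using (h'.mul_const ‖y‖).sqrt
    refine squeeze_zero' (Eventually.of_forall fun _ => norm_nonneg _) ?_ h2
    filter_upwards [hT, hpow k] with i hi hk
    apply Real.le_sqrt_of_sq_le
    have := hi ((T i ^ k) y)
    rw [pow_succ' (T i) (k + 1), pow_succ' (T i) k]
    exact this.trans (mul_le_mul_of_nonneg_left hk (norm_nonneg _))
end

section
variable {E : Type*} [NormedAddCommGroup E] [NormedSpace ℝ E] [FiniteDimensional ℝ E]
  [MeasurableSpace E] [BorelSpace E] {μ : Measure E} [μ.IsAddHaarMeasure]

lemma MeasureTheory.AEStronglyMeasurable.comp_const_smul {F : Type*} [TopologicalSpace F]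
    {f : E → F} (hf : AEStronglyMeasurable f μ) {c : ℝ} (hc : c ≠ 0) :
    AEStronglyMeasurable (fun v => f (c • v)) μ := by
  have : Measure.QuasiMeasurePreserving (fun v : E => c • v) μ μ :=
    ⟨measurable_const_smul c, by
      rw [Measure.map_addHaar_smul μ hc]
      exact Measure.smul_absolutelyContinuous⟩
  exact hf.comp_quasiMeasurePreserving this

/-- Translation is continuous in `L¹`. -/
lemma MeasureTheory.Integrable.tendsto_integral_norm_sub_translate {f : E → ℝ}
    (hf : Integrable f μ) :
    Tendsto (fun w => ∫ v, ‖f v - f (v - w)‖ ∂μ) (nhds 0) (nhds 0) := by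
  have hf1 : MemLp f 1 μ := memLp_one_iff_integrable.2 hf
  let g : C(E, C(E, E)) := (ContinuousMap.mk (fun a : E × E => a.2 - a.1)).curry
  have hg : ∀ w, MeasurePreserving (g w) μ μ := fun w => measurePreserving_sub_right μ w
  have h := (tendsto_const_nhds (x := hf1.toLp f)).compMeasurePreservingLp
    (g.continuous.tendsto 0) hg (hg 0) ENNReal.one_ne_top
  have h2 := (tendsto_const_nhds (x := hf1.toLp f)).sub h
  have h3 := h2.norm
  have h0 : Lp.compMeasurePreserving (g 0) (hg 0) (hf1.toLp f) = hf1.toLp f := by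
    rw [Lp.toLp_compMeasurePreserving hf1 (hg 0)]
    congr 1
    ext v
    simp [g]
  rw [h0, sub_self, norm_zero] at h3
  refine h3.congr fun w => ?_
  rw [Lp.toLp_compMeasurePreserving hf1 (hg w), ← MemLp.toLp_sub, L1.norm_eq_integral_norm]
  refine integral_congr_ae ?_
  filter_upwards [MemLp.coeFn_toLp (hf1.sub (hf1.comp_measurePreserving (hg w)))] with v hv
  rw [hv]
  rfl

lemma exists_mem_nhds_aestronglyMeasurable_of_comp {F : Type*} [NormedAddCommGroup F]
    [NormedSpace ℝ F] {q : E → E} {q' : E → E →L[ℝ] E}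
    (hq : ∀ x, HasStrictFDerivAt q (q' x) x) (hq' : Continuous q') {x : E}
    (hx : (q' x).det ≠ 0) {O : Set E} (hO : O ∈ nhds x) {f : E → F} {C : ℝ} (hC : ∀ v, ‖f v‖ ≤ C)
    (hf : AEStronglyMeasurable (fun t => f (q t)) (μ.restrict O)) :
    ∃ W ∈ nhds (q x), AEStronglyMeasurable f (μ.restrict W) := by
  obtain ⟨⟨u, hu, hxu, hinj⟩, hmap⟩ := (hq x).exists_isOpen_injOn hx
  have hdet : Continuous fun y => |(q' y).det| := (ContinuousLinearMap.continuous_det.comp hq').abs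
  set s := u ∩ interior O ∩ Metric.ball x 1 ∩ {y | |(q' y).det| < |(q' x).det| + 1} with hs
  have hso : IsOpen s := ((hu.inter isOpen_interior).inter Metric.isOpen_ball).inter
    (isOpen_lt hdet continuous_const)
  have hxs : x ∈ s := by
    simp [hs, hxu, mem_interior_iff_mem_nhds.2 hO]
  have hsub : s ⊆ O := fun y hy => interior_subset hy.1.1.2
  refine ⟨q '' s, by rw [← hmap]; exact image_mem_map (hso.mem_nhds hxs), ?_⟩
  suffices IntegrableOn f (q '' s) μ from this.1
  rw [integrableOn_image_iff_integrableOn_abs_det_fderiv_smul μ hso.measurableSet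
    (fun y _ => (hq y).hasFDerivAt.hasFDerivWithinAt) (hinj.mono fun y hy => hy.1.1.1)]
  have hfin : μ s < ⊤ := (measure_mono fun y hy => hy.1.2).trans_lt
    (measure_ball_lt_top (x := x) (r := 1))
  refine ⟨hdet.aestronglyMeasurable.smul (hf.mono_measure (Measure.restrict_mono hsub le_rfl)),
    .restrict_of_bounded (C := (|(q' x).det| + 1) * C) hfin ?_⟩
  filter_upwards [ae_restrict_mem hso.measurableSet] with y hy
  rw [norm_smul, Real.norm_eq_abs, abs_abs]
  exact mul_le_mul hy.2.le (hC _) (norm_nonneg _) (by positivity)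

variable {H : Type*} [NormedAddCommGroup H] [InnerProductSpace ℂ H]
  {U : E → H →ₗᵢ[ℂ] H}

lemma aestronglyMeasurable_of_mem_nhds (hU : ∀ s t x, U (s + t) x = U s (U t x)) {v : E} {y : H}
    {W : Set E} (hW : W ∈ nhds v)
    (hf : AEStronglyMeasurable (fun v => U v y) (μ.restrict W)) :
    AEStronglyMeasurable (fun v => U v y) μ := by
  obtain ⟨O, hOW, hO, hvO⟩ := mem_nhds_iff.1 hW
  have key : ∀ w : E, AEStronglyMeasurable (fun v => U v y)
      (μ.restrict ((fun z => z - w) ⁻¹' O)) := by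
    intro w
    have h := (hf.mono_measure (Measure.restrict_mono hOW le_rfl)).comp_measurePreserving
      ((measurePreserving_sub_right μ w).restrict_preimage hO.measurableSet)
    refine ((U w).continuous.comp_aestronglyMeasurable h).congr (Eventually.of_forall fun z => ?_)
    simp [← hU]
  obtain ⟨s, hs, hsu⟩ := TopologicalSpace.countable_cover_nhds
    (f := fun z : E => (fun z' => z' - (z - v)) ⁻¹' O) fun z =>
      (hO.preimage (by fun_prop)).mem_nhds (by simpa using hvO)
  have := hs.to_subtype
  rw [← Measure.restrict_univ (μ := μ), ← hsu, Set.biUnion_eq_iUnion,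
    aestronglyMeasurable_iUnion_iff]
  exact fun i => key _

variable [CompleteSpace H]

/-- The mean ergodic theorem for dilates of an absolutely continuous measure. -/
lemma tendsto_integral_smul_apply_zero (hU : ∀ s t x, U (s + t) x = U s (U t x))
    (hinv : ∀ x : H, (∀ t, U t x = x) → x = 0)
    (hmeas : ∀ y, AEStronglyMeasurable (fun v => U v y) μ) {f : E → ℝ} (hf : Integrable f μ)
    (y : H) : Tendsto (fun c : ℝ => ∫ v, f v • U (c • v) y ∂μ) atTop (nhds 0) := by
  have hint : ∀ (c : ℝ), c ≠ 0 → ∀ y, Integrable (fun v => f v • U (c • v) y) μ := by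
    intro c hc y
    exact hf.smul_bdd ‖y‖ ((hmeas y).comp_const_smul hc) (by simp)
  have hbd : ∀ (c : ℝ) y, ‖∫ v, f v • U (c • v) y ∂μ‖ ≤ (∫ v, ‖f v‖ ∂μ) * ‖y‖ := by
    intro c y
    refine (norm_integral_le_integral_norm _).trans_eq ?_
    simp [norm_smul, integral_mul_const]
  have hne : ∀ᶠ c : ℝ in atTop, c ≠ 0 := eventually_ne_atTop 0
  let S : Submodule ℂ H :=
    { carrier := {y | Tendsto (fun c : ℝ => ∫ v, f v • U (c • v) y ∂μ) atTop (nhds 0)}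
      zero_mem' := by simp
      add_mem' := by
        intro y z hy hz
        have := Tendsto.add hy hz
        rw [add_zero] at this
        refine this.congr' ?_
        filter_upwards [hne] with c hc
        simp [integral_add (hint c hc y) (hint c hc z)]
      smul_mem' := by
        intro a y hy
        have := Tendsto.const_smul hy a
        rw [smul_zero] at this
        refine this.congr fun c => ?_
        rw [← integral_smul]
        congr 1
        ext v
        rw [map_smul, smul_comm] }
  have hS : IsClosed (S : Set H) := by
    rw [← isSeqClosed_iff_isClosed]
    intro u z hu hz
    have hlim : Tendsto (fun k => (∫ v, ‖f v‖ ∂μ) * ‖z - u k‖) atTop (nhds 0) := by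
      simpa using ((tendsto_const_nhds (x := z)).sub hz).norm.const_mul (∫ v, ‖f v‖ ∂μ)
    change Tendsto _ _ _
    rw [Metric.tendsto_nhds]
    intro ε hε
    obtain ⟨k, hk⟩ := (hlim.eventually_lt_const (half_pos hε)).exists
    filter_upwards [hne, (Metric.tendsto_nhds.1 (hu k)) (ε / 2) (half_pos hε)] with c hc hck
    rw [dist_zero_right] at hck ⊢
    have h1 : ∫ v, f v • U (c • v) z ∂μ = ∫ v, f v • U (c • v) (z - u k) ∂μ +
        ∫ v, f v • U (c • v) (u k) ∂μ := by
      rw [← integral_add (hint c hc _) (hint c hc _)]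
      simp [← smul_add]
    rw [h1]
    calc _ ≤ _ := norm_add_le _ _
      _ < ε / 2 + ε / 2 := add_lt_add ((hbd c _).trans_lt hk) hck
      _ = ε := add_halves ε
  have hmem : ∀ g y, y - U g y ∈ S := by
    intro g y
    change Tendsto _ _ _
    have hg : Tendsto (fun c : ℝ => c⁻¹ • g) atTop (nhds 0) := by
      simpa using (tendsto_inv_atTop_zero (𝕜 := ℝ)).smul_const g
    have h := (hf.tendsto_integral_norm_sub_translate.comp hg).mul_const ‖y‖
    rw [zero_mul] at h
    refine squeeze_zero_norm' ?_ h
    filter_upwards [hne] with c hc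
    have h1 : ∫ v, f v • U (c • v) (U g y) ∂μ = ∫ v, f (v - c⁻¹ • g) • U (c • v) y ∂μ := by
      rw [← integral_sub_right_eq_self (μ := μ) (fun v => f v • U (c • v) (U g y)) (c⁻¹ • g)]
      congr 1
      ext v
      rw [← hU, smul_sub, smul_inv_smul₀ hc, sub_add_cancel]
    have h2 : ∫ v, f v • U (c • v) (y - U g y) ∂μ =
        ∫ v, (f v - f (v - c⁻¹ • g)) • U (c • v) y ∂μ := by
      simp only [map_sub, smul_sub, sub_smul]
      rw [integral_sub (hint c hc _) (hint c hc _), h1, integral_sub (hint c hc _)]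
      exact (hf.comp_sub_right _).smul_bdd ‖y‖ ((hmeas y).comp_const_smul hc) (by simp)
    rw [h2]
    refine (norm_integral_le_integral_norm _).trans_eq ?_
    simp [norm_smul, integral_mul_const]
  have := hS.completeSpace_coe
  have htop : S = ⊤ := by
    rw [← Submodule.orthogonal_eq_bot_iff, eq_bot_iff]
    intro z hz
    refine hinv z fun t => ?_
    have h0 := (Submodule.mem_orthogonal' S z).1 hz _ (hmem t z)
    rw [inner_sub_right, inner_self_eq_norm_sq_to_K, sub_eq_zero] at h0
    have h1 : ‖z - U t z‖ ^ 2 = 0 := by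
      rw [norm_sub_sq (𝕜 := ℂ), ← h0, (U t).norm_map]
      norm_cast
      ring
    exact (sub_eq_zero.1 (norm_eq_zero.1 (pow_eq_zero_iff two_ne_zero |>.1 h1))).symm
  exact (htop ▸ Submodule.mem_top : y ∈ S)
end

section
variable {E : Type*} [NormedAddCommGroup E] [NormedSpace ℝ E] [FiniteDimensional ℝ E]
  [MeasurableSpace E] [BorelSpace E] {μ : Measure E} [μ.IsAddHaarMeasure]
  {H : Type*} [NormedAddCommGroup H] [InnerProductSpace ℂ H] [SecondCountableTopology H]
  {U : E → H →ₗᵢ[ℂ] H}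

/-- An almost everywhere strongly measurable orbit map of a unitary representation is continuous. -/
lemma continuous_of_aestronglyMeasurable (hU : ∀ s t x, U (s + t) x = U s (U t x)) {y : H}
    (hmeas : AEStronglyMeasurable (fun v => U v y) μ) : Continuous fun v => U v y := by
  have hzero : ∀ ε > 0, ∀ᶠ w in nhds (0 : E), ‖U w y - y‖ < ε := by
    intro ε hε
    obtain ⟨h, hh⟩ : ∃ k : ℕ, 0 < μ ((fun v => U v y) ⁻¹' Metric.ball
        (TopologicalSpace.denseSeq H k) (ε / 2)) := by
      by_contra! hcon
      have huniv : (Set.univ : Set E) ⊆ ⋃ k : ℕ, (fun v => U v y) ⁻¹' Metric.ball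
          (TopologicalSpace.denseSeq H k) (ε / 2) := by
        intro v _
        obtain ⟨k, hk⟩ := (TopologicalSpace.denseRange_denseSeq H).exists_dist_lt (U v y)
          (half_pos hε)
        exact Set.mem_iUnion.2 ⟨k, hk⟩
      have := measure_mono_null huniv (measure_iUnion_null fun k => nonpos_iff_eq_zero.1 (hcon k))
      exact NeZero.ne μ (Measure.measure_univ_eq_zero.1 this)
    borelize H
    have hnull : NullMeasurableSet ((fun v => U v y) ⁻¹' Metric.ball
        (TopologicalSpace.denseSeq H h) (ε / 2)) μ :=
      hmeas.aemeasurable.nullMeasurable Metric.isOpen_ball.measurableSet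
    obtain ⟨A, hA, hAm, hAe⟩ := hnull.exists_measurable_subset_ae_eq
    rw [← measure_congr hAe] at hh
    filter_upwards [Measure.sub_mem_nhds_zero_of_addHaar_pos μ A hAm hh] with w hw
    obtain ⟨a, ha, b, hb, rfl⟩ := Set.mem_sub.1 hw
    rw [← (U b).norm_map, map_sub, ← hU, add_sub_cancel, ← dist_eq_norm]
    calc _ ≤ _ := dist_triangle_right _ _ _
      _ < ε / 2 + ε / 2 := add_lt_add (hA ha) (hA hb)
      _ = ε := add_halves ε
  rw [continuous_iff_continuousAt]
  intro v
  rw [Metric.continuousAt_iff']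
  intro ε hε
  have ht : Tendsto (fun w => w - v) (nhds v) (nhds 0) := by
    have : Continuous fun w => w - v := by fun_prop
    simpa using this.tendsto v
  filter_upwards [ht.eventually (hzero ε hε)] with w hw
  rw [dist_eq_norm]
  convert! hw using 1
  rw [← (U v).norm_map (U (w - v) y - y), map_sub, ← hU, add_sub_cancel]

end

section
variable {n : ℕ} (P : Fin n → Polynomial ℝ)

/-- The derivative of `t ↦ ∑ i, p (t i)`, where `p` is the curve with coordinates `P`. -/
noncomputable def sumCurveDeriv (t : Fin n → ℝ) : (Fin n → ℝ) →L[ℝ] (Fin n → ℝ) :=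
  ContinuousLinearMap.pi fun j =>
    ∑ i, ((P j).derivative.eval (t i)) • ContinuousLinearMap.proj (R := ℝ) i

lemma hasStrictFDerivAt_sumCurve (t : Fin n → ℝ) :
    HasStrictFDerivAt (fun t : Fin n → ℝ => ∑ i, fun j => (P j).eval (t i))
      (sumCurveDeriv P t) t := by
  rw [hasStrictFDerivAt_pi']
  intro j
  have h := HasStrictFDerivAt.fun_sum (u := Finset.univ) fun i (_ : i ∈ Finset.univ) =>
    ((P j).hasStrictDerivAt (t i)).comp_hasStrictFDerivAt t
      (ContinuousLinearMap.proj (R := ℝ) (φ := fun _ : Fin n => ℝ) i).hasStrictFDerivAt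
  convert! h using 1
  ext t
  simp

lemma continuous_sumCurveDeriv : Continuous (sumCurveDeriv P) := by
  refine continuous_clm_apply.2 fun v => continuous_pi fun j => ?_
  simp only [sumCurveDeriv, ContinuousLinearMap.coe_pi', sum_apply,
    smul_apply, ContinuousLinearMap.proj_apply]
  fun_prop

lemma det_sumCurveDeriv (t : Fin n → ℝ) :
    (sumCurveDeriv P t).det = (Matrix.of fun j i => (P j).derivative.eval (t i)).det := by
  rw [← LinearMap.det_toLin']
  unfold ContinuousLinearMap.det
  congr 1
  ext v j
  simp [sumCurveDeriv, Matrix.mulVec, dotProduct]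

variable {P}

lemma ae_det_sumCurveDeriv_ne_zero
    (hP : ¬ ∃ (ν : Fin n → ℝ) (c : ℝ), ν ≠ 0 ∧
      ∀ t ∈ Set.Icc (0:ℝ) 1, ∑ i, ν i * (P i).eval t = c) :
    ∀ᵐ t : Fin n → ℝ, (sumCurveDeriv P t).det ≠ 0 := by
  let D : MvPolynomial (Fin n) ℝ :=
    (Matrix.of fun j i => Polynomial.aeval (MvPolynomial.X i) (P j).derivative).det
  have hD : ∀ t, MvPolynomial.eval t D = (sumCurveDeriv P t).det := by
    intro t
    rw [det_sumCurveDeriv, RingHom.map_det]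
    congr 1
    ext j i
    simp only [RingHom.mapMatrix_apply, Matrix.map_apply, Matrix.of_apply]
    rw [← MvPolynomial.coe_aeval_eq_eval, RingHom.coe_coe, ← Polynomial.aeval_algHom_apply]
    simp [Polynomial.aeval_def, Polynomial.eval₂_eq_eval_map]
  obtain ⟨t, ht⟩ := exists_det_ne_zero (fun t j => (P j).derivative.eval t) fun ν hν => by
    by_contra hne
    refine hP ⟨ν, (∑ i, Polynomial.C (ν i) * P i).coeff 0, hne, fun t _ => ?_⟩
    have hder : (∑ i, Polynomial.C (ν i) * P i).derivative = 0 :=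
      Polynomial.funext fun t => by simpa [Polynomial.eval_finsetSum] using hν t
    have := congrArg (Polynomial.eval t) (Polynomial.eq_C_of_derivative_eq_zero hder)
    rw [Polynomial.eval_C] at this
    rw [← this]
    simp [Polynomial.eval_finsetSum]
  rw [← det_sumCurveDeriv, ← hD] at ht
  have hD0 : D ≠ 0 := by
    rintro h
    simp [h] at ht
  have := MvPolynomial.volume_setOf_eval_eq_zero D hD0
  rw [measure_eq_zero_iff_ae_notMem] at this
  filter_upwards [this] with t ht
  rw [← hD]
  exact ht

variable {H : Type*} [NormedAddCommGroup H] [InnerProductSpace ℂ H] [CompleteSpace H]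
    [SecondCountableTopology H]

/-- If all orbit maps are measurable along one dilate of a nondegenerate polynomial curve, then the
representation is strongly continuous. -/
lemma continuous_of_aestronglyMeasurable_curve {U : (Fin n → ℝ) → H →ₗᵢ[ℂ] H}
    (hU : ∀ s t x, U (s + t) x = U s (U t x)) (hU0 : ∀ x, U 0 x = x)
    (hP : ¬ ∃ (ν : Fin n → ℝ) (c : ℝ), ν ≠ 0 ∧
      ∀ t ∈ Set.Icc (0:ℝ) 1, ∑ i, ν i * (P i).eval t = c) {c : ℝ} (hc : c ≠ 0)
    (hmeas : ∀ y, AEStronglyMeasurable (fun t => U (c • fun j => (P j).eval t) y)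
      (volume.restrict (Set.Ioc 0 1))) (y : H) :
    Continuous fun v => U v y := by
  obtain ⟨T, hT⟩ := exists_clm_eq_integral hmeas
  have hq := (integral_pi_sum_eq_pow hU hU0 hmeas hT n y).1
  rw [← Measure.restrict_pi_pi, ← volume_pi] at hq
  simp_rw [← Finset.smul_sum] at hq
  set O : Set (Fin n → ℝ) := Set.pi Set.univ fun _ => Set.Ioo (0 : ℝ) 1
  have hO : IsOpen O := isOpen_set_pi Set.finite_univ fun _ _ => isOpen_Ioo
  have hOne : O.Nonempty := ⟨fun _ => 1 / 2, fun _ _ => by norm_num⟩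
  obtain ⟨t, ht, htO⟩ : ∃ t, (sumCurveDeriv P t).det ≠ 0 ∧ t ∈ O := by
    by_contra! hcon
    exact (hO.measure_pos volume hOne).ne' (measure_mono_null
      (fun t ht h => hcon t h ht) (ae_det_sumCurveDeriv_ne_zero hP))
  obtain ⟨W, hW, hWm⟩ := exists_mem_nhds_aestronglyMeasurable_of_comp (μ := volume)
    (f := fun v => U (c • v) y) (C := ‖y‖)
    (hasStrictFDerivAt_sumCurve P) (continuous_sumCurveDeriv P) ht (hO.mem_nhds htO) (by simp)
    (hq.mono_measure (Measure.restrict_mono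
      (Set.pi_mono fun _ _ => Set.Ioo_subset_Ioc_self) le_rfl))
  have h := aestronglyMeasurable_of_mem_nhds (U := fun v => U (c • v))
    (fun s t x => by rw [smul_add, hU]) hW hWm
  have h' := h.comp_const_smul (inv_ne_zero hc)
  simp_rw [smul_inv_smul₀ hc] at h'
  exact continuous_of_aestronglyMeasurable hU h'

lemma tendsto_integral_curve_of_aestronglyMeasurable {U : (Fin n → ℝ) → H →ₗᵢ[ℂ] H}
    (hU : ∀ s t x, U (s + t) x = U s (U t x))
    (hinv : ∀ x : H, (∀ t, U t x = x) → x = 0)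
    (hP : ¬ ∃ (ν : Fin n → ℝ) (c : ℝ), ν ≠ 0 ∧
      ∀ t ∈ Set.Icc (0:ℝ) 1, ∑ i, ν i * (P i).eval t = c) {c : ℝ} (hc : c ≠ 0)
    (hmeas : ∀ y, AEStronglyMeasurable (fun t => U (c • fun j => (P j).eval t) y)
      (volume.restrict (Set.Ioc 0 1))) (x : H) :
    Tendsto (fun lam : ℝ => ‖∫ t in Set.Ioc (0 : ℝ) 1, U (lam • fun j => (P j).eval t) x‖)
      atTop (nhds 0) := by
  have hU0 : ∀ x, U 0 x = x := fun x => (U 0).injective (by rw [← hU, add_zero])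
  have hcont := continuous_of_aestronglyMeasurable_curve hU hU0 hP hc hmeas
  have hcurve : Continuous fun t : ℝ => fun j => (P j).eval t :=
    continuous_pi fun j => (P j).continuous
  have hm : ∀ (lam : ℝ) y, AEStronglyMeasurable (fun t => U (lam • fun j => (P j).eval t) y)
      (volume.restrict (Set.Ioc 0 1)) := fun lam y =>
    ((hcont y).comp (hcurve.const_smul lam)).aestronglyMeasurable
  choose T hT using fun lam => exists_clm_eq_integral (hm lam)
  simp_rw [← hT]
  refine tendsto_apply_zero_of_tendsto_pow
    (Eventually.of_forall fun lam y => norm_sq_le_of_eq_integral hU hU0 (hm lam) (hT lam) y)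
    (Eventually.of_forall fun lam y => ?_) x n ?_
  · rw [hT]
    refine (norm_integral_le_of_norm_le_const (C := ‖y‖) (by simp)).trans (by simp)
  set M : Measure (Fin n → ℝ) := Measure.pi fun _ => volume.restrict (Set.Ioc (0 : ℝ) 1) with hM
  set q : (Fin n → ℝ) → (Fin n → ℝ) := fun t => ∑ i, fun j => (P j).eval (t i)
  have hqmp : Measure.QuasiMeasurePreserving q volume volume :=
    quasiMeasurePreserving_of_ae_det_ne_zero volume (hasStrictFDerivAt_sumCurve P)
      (ae_det_sumCurveDeriv_ne_zero hP)
  have hMac : M ≪ volume := by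
    rw [hM, ← Measure.restrict_pi_pi, ← volume_pi]
    exact Measure.restrict_le_self.absolutelyContinuous
  have hac : M.map q ≪ volume := (hMac.map hqmp.measurable).trans hqmp.absolutelyContinuous
  have hfin : IsFiniteMeasure (M.map q) := inferInstance
  have hlim := (tendsto_integral_smul_apply_zero (μ := volume) hU hinv
    (fun y => (hcont y).aestronglyMeasurable)
    (Measure.integrable_toReal_rnDeriv (μ := M.map q) (ν := volume)) x).norm
  rw [norm_zero] at hlim
  refine hlim.congr fun lam => ?_
  have hmap := integral_map (μ := M) (f := fun v => U (lam • v) x) hqmp.measurable.aemeasurable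
    ((hcont x).comp (continuous_const_smul lam)).aestronglyMeasurable
  rw [integral_rnDeriv_smul hac, hmap,
    ← (integral_pi_sum_eq_pow hU hU0 (hm lam) (hT lam) n x).2]
  simp_rw [q, Finset.smul_sum]
  rfl

end

/-- Let `U` be a unitary representation of the additive group `ℝ^n` on a separable complex
Hilbert space `H` with no nonzero invariant vectors. Let `p : ℝ → ℝ^n` be a polynomial curve
whose image `p([0,1])` is not contained in any proper affine subspace of `ℝ^n` (i.e. in any
affine hyperplane). For `x ∈ H` set `x_λ = ∫₀¹ U_{λ p(t)} x dt` (Bochner integral).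
Then `‖x_λ‖ → 0` as `λ → ∞`. -/
theorem mean_ergodic_hilbert
    {H : Type*} [NormedAddCommGroup H] [InnerProductSpace ℂ H] [CompleteSpace H]
    [SecondCountableTopology H]
    {n : ℕ} (U : (Fin n → ℝ) → (H ≃ₗᵢ[ℂ] H))
    (hU : ∀ s t : Fin n → ℝ, U (s + t) = (U s).trans (U t))
    (hinv : ∀ x : H, (∀ t : Fin n → ℝ, U t x = x) → x = 0)
    (P : Fin n → Polynomial ℝ)
    (hP : ¬ ∃ (ν : Fin n → ℝ) (c : ℝ), ν ≠ 0 ∧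
      ∀ t ∈ Set.Icc (0:ℝ) 1, ∑ i, ν i * (P i).eval t = c)
    (x : H) :
    Tendsto (fun lam : ℝ =>
        ‖∫ t in (0:ℝ)..1, U (fun i => lam * (P i).eval t) x‖)
      atTop (nhds 0) := by
  have hU' : ∀ s t x, U (s + t) x = U s (U t x) := fun s t x => by
    rw [add_comm, hU, LinearIsometryEquiv.trans_apply]
  simp_rw [intervalIntegral.integral_of_le zero_le_one]
  change Tendsto (fun lam : ℝ =>
    ‖∫ t in Set.Ioc (0 : ℝ) 1, U (lam • fun i => (P i).eval t) x‖) atTop (nhds 0)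
  by_cases hex : ∃ c : ℝ, c ≠ 0 ∧ AEStronglyMeasurable
      (fun t => U (c • fun i => (P i).eval t) x) (volume.restrict (Set.Ioc 0 1))
  swap
  · push Not at hex
    refine tendsto_const_nhds.congr' ?_
    filter_upwards [eventually_ne_atTop 0] with c hc
    rw [integral_non_aestronglyMeasurable (hex c hc), norm_zero]
  obtain ⟨c, hc, hx⟩ := hex
  let K : Submodule ℂ H :=
    { carrier := {y | AEStronglyMeasurable (fun t => U (c • fun i => (P i).eval t) y)
        (volume.restrict (Set.Ioc 0 1))}
      zero_mem' := by simp [aestronglyMeasurable_const]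
      add_mem' := fun {y z} hy hz => by
        simp only [Set.mem_ofPred_eq, map_add]
        exact AEStronglyMeasurable.add hy hz
      smul_mem' := fun a y hy => by
        simp only [Set.mem_ofPred_eq, map_smul]
        exact AEStronglyMeasurable.const_smul hy a }
  have hK : IsClosed (K : Set H) := by
    rw [← isSeqClosed_iff_isClosed]
    intro u z hu hz
    exact aestronglyMeasurable_of_tendsto_ae atTop hu
      (Eventually.of_forall fun t => ((U _).continuous.tendsto _).comp hz)
  have hKU : ∀ s, ∀ y ∈ K, (U s).toLinearEquiv.toLinearMap y ∈ K := fun s y hy => by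
    refine ((U s).continuous.comp_aestronglyMeasurable hy).congr (Eventually.of_forall fun t => ?_)
    change U s (U _ y) = U _ (U s y)
    rw [← hU', ← hU', add_comm]
  have hKc := hK.completeSpace_coe
  let V : (Fin n → ℝ) → K →ₗᵢ[ℂ] K := fun s =>
    ⟨(U s).toLinearEquiv.toLinearMap.restrict (hKU s), fun y => (U s).norm_map y⟩
  have hV : ∀ s (y : K), (V s y : H) = U s y := fun s y => rfl
  have key := tendsto_integral_curve_of_aestronglyMeasurable (U := V)
    (fun s t y => Subtype.ext (by simp only [hV, hU']))
    (fun y hy => Subtype.ext (hinv y fun t => by rw [← hV, hy])) hP hc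
    (fun y => Topology.IsEmbedding.subtypeVal.aestronglyMeasurable_comp_iff.1 y.2) ⟨x, hx⟩
  refine key.congr fun lam => ?_
  rw [← K.subtypeₗᵢ.norm_map]
  congr 1
  exact (K.subtypeₗᵢ.integral_comp_comm _).symm
end

section
/- (Van der Corput's Lemma.) For every positive integer d there exists a constant C > 0, depending only on d, such that for every polynomial φ(t) = ∑_{k=1}^{d} a_k t^k with real coefficients a_1, …, a_d, not all zero, one has |∫₀¹ e^{i φ(t)} dt| ≤ C / (∑_{k=1}^{d} |a_k|)^{1/d}. -/
open MeasureTheory Finset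

open Polynomial in
/-- Integration by parts for an oscillatory integral whose phase has no stationary point. -/
lemma norm_integral_exp_eval_le_add (p : ℝ[X]) {u v s : ℝ} (huv : u ≤ v) (hs : 0 < s)
    (h : ∀ x ∈ Set.Icc u v, s ≤ |p.derivative.eval x|) :
    ‖∫ x in u..v, Complex.exp (Complex.I * (p.eval x : ℝ))‖ ≤
      2 / s + ∫ x in u..v, |p.derivative.derivative.eval x| / (p.derivative.eval x) ^ 2 := by
  set q := p.derivative with hq
  have hne : ∀ x ∈ Set.Icc u v, q.eval x ≠ 0 := fun x hx h0 => by
    have := h x hx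
    rw [h0, abs_zero] at this
    linarith
  have hneC : ∀ x ∈ Set.Icc u v, ((q.eval x : ℝ) : ℂ) ≠ 0 := fun x hx =>
    Complex.ofReal_ne_zero.mpr (hne x hx)
  have hcont : ∀ r : ℝ[X], Continuous fun x : ℝ => ((r.eval x : ℝ) : ℂ) := fun r =>
    Complex.continuous_ofReal.comp r.continuous
  have hexp : Continuous fun x : ℝ => Complex.exp (Complex.I * (p.eval x : ℝ)) :=
    Complex.continuous_exp.comp (continuous_const.mul (hcont p))
  have hnorm : ∀ x : ℝ, ‖Complex.exp (Complex.I * (p.eval x : ℝ))‖ = 1 := fun x => by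
    rw [mul_comm, Complex.norm_exp_ofReal_mul_I]
  set G : ℝ → ℂ := fun x => Complex.exp (Complex.I * (p.eval x : ℝ)) / (Complex.I * (q.eval x : ℝ))
    with hG
  set R : ℝ → ℂ := fun x => Complex.exp (Complex.I * (p.eval x : ℝ)) *
    (q.derivative.eval x : ℝ) / (Complex.I * ((q.eval x : ℝ) : ℂ) ^ 2) with hR
  have hderiv : ∀ x ∈ Set.uIcc u v,
      HasDerivAt G (Complex.exp (Complex.I * (p.eval x : ℝ)) - R x) x := by
    intro x hx
    rw [Set.uIcc_of_le huv] at hx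
    have h1 := ((p.hasDerivAt x).ofReal_comp.const_mul Complex.I).cexp
    have h2 := (q.hasDerivAt x).ofReal_comp.const_mul Complex.I
    have hx0 := hneC x hx
    refine (h1.div h2 (mul_ne_zero Complex.I_ne_zero hx0)).congr_deriv ?_
    simp only [hR, ← hq]
    field_simp
  have hRc : ContinuousOn R (Set.uIcc u v) := by
    rw [Set.uIcc_of_le huv]
    refine (hexp.mul (hcont _)).continuousOn.div
      (continuous_const.mul ((hcont q).pow 2)).continuousOn fun x hx => ?_
    exact mul_ne_zero Complex.I_ne_zero (pow_ne_zero 2 (hneC x hx))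
  have hRi := hRc.intervalIntegrable (μ := MeasureTheory.volume)
  have hEi := hexp.intervalIntegrable (μ := MeasureTheory.volume) u v
  have hmain := intervalIntegral.integral_eq_sub_of_hasDerivAt hderiv (hEi.sub hRi)
  rw [intervalIntegral.integral_sub hEi hRi] at hmain
  have hGle : ∀ x ∈ Set.Icc u v, ‖G x‖ ≤ 1 / s := fun x hx => by
    simp only [hG, norm_div, norm_mul, hnorm, Complex.norm_I, one_mul, Complex.norm_real,
      Real.norm_eq_abs]
    exact one_div_le_one_div_of_le hs (h x hx)
  have hRn : ‖∫ x in u..v, R x‖ ≤ ∫ x in u..v, |q.derivative.eval x| / (q.eval x) ^ 2 := by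
    refine (intervalIntegral.norm_integral_le_integral_norm huv).trans_eq ?_
    congr 1
    ext x
    simp only [hR, norm_div, norm_mul, hnorm, Complex.norm_I, one_mul, Complex.norm_real,
      Real.norm_eq_abs, norm_pow, sq_abs]
  rw [sub_eq_iff_eq_add.mp hmain]
  have hu := hGle u (Set.left_mem_Icc.mpr huv)
  have hv := hGle v (Set.right_mem_Icc.mpr huv)
  calc ‖G v - G u + ∫ x in u..v, R x‖ ≤ ‖G v‖ + ‖G u‖ + ‖∫ x in u..v, R x‖ :=
        (norm_add_le _ _).trans (by gcongr; exact norm_sub_le _ _)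
    _ ≤ 1 / s + 1 / s + ∫ x in u..v, |q.derivative.eval x| / (q.eval x) ^ 2 := by gcongr
    _ = _ := by ring

open Polynomial in
/-- The first derivative test: the derivative of the phase is monotone and bounded below. -/
lemma norm_integral_exp_eval_le_of_derivative (p : ℝ[X]) {u v s : ℝ} (huv : u ≤ v) (hs : 0 < s)
    (h : ∀ x ∈ Set.Icc u v, s ≤ |p.derivative.eval x|)
    (h2 : ∀ x ∈ Set.Icc u v, p.derivative.derivative.eval x ≠ 0) :
    ‖∫ x in u..v, Complex.exp (Complex.I * (p.eval x : ℝ))‖ ≤ 4 / s := by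
  refine (norm_integral_exp_eval_le_add p huv hs h).trans ?_
  set q := p.derivative with hq
  have hne : ∀ x ∈ Set.Icc u v, q.eval x ≠ 0 := fun x hx h0 => by
    have := h x hx
    rw [h0, abs_zero] at this
    linarith
  have hsign : ∃ e : ℝ, |e| = 1 ∧ ∀ x ∈ Set.Icc u v, |q.derivative.eval x| =
      e * q.derivative.eval x := by
    have hu := Set.left_mem_Icc.mpr huv
    have key : ∀ x ∈ Set.Icc u v, 0 < q.derivative.eval u * q.derivative.eval x := by
      intro x hx
      by_contra! hneg
      have hivt := intermediate_value_uIcc (a := u) (b := x) (f := fun y => q.derivative.eval y)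
        q.derivative.continuous.continuousOn
      have h0 : (0 : ℝ) ∈ Set.uIcc (q.derivative.eval u) (q.derivative.eval x) := by
        rw [Set.mem_uIcc]
        rcases mul_nonpos_iff.mp hneg with h | h
        · exact Or.inr ⟨h.2, h.1⟩
        · exact Or.inl ⟨h.1, h.2⟩
      obtain ⟨y, hy, hy0⟩ := hivt h0
      rw [Set.uIcc_of_le hx.1] at hy
      exact h2 y ⟨hy.1, hy.2.trans hx.2⟩ hy0
    rcases lt_or_gt_of_ne (h2 u hu) with hlt | hgt
    · refine ⟨-1, by simp, fun x hx => ?_⟩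
      rw [abs_of_neg (neg_of_mul_pos_right (key x hx) hlt.le)]
      ring
    · refine ⟨1, by simp, fun x hx => ?_⟩
      rw [abs_of_pos (pos_of_mul_pos_right (key x hx) hgt.le), one_mul]
  obtain ⟨e, he, hesign⟩ := hsign
  have hint : ∫ x in u..v, |q.derivative.eval x| / (q.eval x) ^ 2 =
      -e / q.eval v - -e / q.eval u := by
    have hcongr : ∫ x in u..v, |q.derivative.eval x| / (q.eval x) ^ 2 =
        ∫ x in u..v, e * q.derivative.eval x / (q.eval x) ^ 2 := by
      refine intervalIntegral.integral_congr fun x hx => ?_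
      rw [Set.uIcc_of_le huv] at hx
      simp only [hesign x hx]
    rw [hcongr]
    refine intervalIntegral.integral_eq_sub_of_hasDerivAt (f := fun x => -e / q.eval x) ?_ ?_
    · intro x hx
      rw [Set.uIcc_of_le huv] at hx
      refine ((hasDerivAt_const x (-e)).div (q.hasDerivAt x) (hne x hx)).congr_deriv ?_
      ring
    · refine ContinuousOn.intervalIntegrable ?_
      rw [Set.uIcc_of_le huv]
      exact (continuous_const.mul q.derivative.continuous).continuousOn.div
        (q.continuous.pow 2).continuousOn fun x hx => pow_ne_zero 2 (hne x hx)
  have hle : ∀ x ∈ Set.Icc u v, |-e / q.eval x| ≤ 1 / s := fun x hx => by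
    rw [abs_div, abs_neg, he]
    exact one_div_le_one_div_of_le hs (h x hx)
  have h1 := abs_le.mp (hle v (Set.right_mem_Icc.mpr huv))
  have h3 := abs_le.mp (hle u (Set.left_mem_Icc.mpr huv))
  rw [hint]
  have : 4 / s = 2 / s + (1 / s + 1 / s) := by ring
  linarith [h1.2, h3.1]

open Polynomial in
/-- Away from a short interval, a function whose derivative is at least `m * s` is at least `m`.
Hence a bound on integrals over intervals where the function is at least `m` extends to a bound on
intervals where its derivative is at least `m * s`. -/
lemma norm_integral_le_of_derivative_ge {F : ℝ → ℂ} (hF : Continuous F) (hF1 : ∀ x, ‖F x‖ ≤ 1)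
    (g : ℝ[X]) {a b s m A : ℝ} (hab : a ≤ b) (hs : 0 < s) (hm : 0 < m) (hA : 0 ≤ A)
    (hg : ∀ x ∈ Set.Icc a b, m * s ≤ |g.derivative.eval x|)
    (hsub : ∀ u v, u ≤ v → Set.Icc u v ⊆ Set.Icc a b → (∀ x ∈ Set.Icc u v, m ≤ |g.eval x|) →
      ‖∫ x in u..v, F x‖ ≤ A / s) :
    ‖∫ x in a..b, F x‖ ≤ (2 * A + 4) / s := by
  obtain ⟨c, hc, hmin⟩ := isCompact_Icc.exists_isMinOn (Set.nonempty_Icc.mpr hab)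
    (f := fun x => |g.eval x|) g.continuous.abs.continuousOn
  have hgrow : ∀ x ∈ Set.Icc a b, 2 / s ≤ |x - c| → m ≤ |g.eval x| := by
    intro x hx hxc
    have hmvt : m * s * |x - c| ≤ |g.eval x - g.eval c| := by
      have aux : ∀ y z : ℝ, y ∈ Set.Icc a b → z ∈ Set.Icc a b → y < z →
          m * s * |z - y| ≤ |g.eval z - g.eval y| := by
        intro y z hy hz hyz
        obtain ⟨w, hw, hw'⟩ := exists_hasDerivAt_eq_slope (fun x => g.eval x)
          (fun x => g.derivative.eval x) hyz g.continuous.continuousOn fun x _ => g.hasDerivAt x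
        rw [eq_div_iff (sub_pos.mpr hyz).ne'] at hw'
        rw [← hw', abs_mul]
        gcongr
        exact hg w ⟨hy.1.trans hw.1.le, hw.2.le.trans hz.2⟩
      rcases lt_trichotomy c x with h | h | h
      · exact aux c x hc hx h
      · simp [h]
      · rw [abs_sub_comm, abs_sub_comm (g.eval x)]
        exact aux x c hx hc h
    have h1 : |g.eval c| ≤ |g.eval x| := hmin hx
    have h2 : 2 * m ≤ m * s * |x - c| := by
      calc 2 * m = m * s * (2 / s) := by field_simp
        _ ≤ _ := by gcongr
    have h3 := abs_sub (g.eval x) (g.eval c)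
    linarith
  have hδ : 0 < 2 / s := by positivity
  set u := max a (c - 2 / s) with hu
  set v := min b (c + 2 / s) with hv
  have hau : a ≤ u := le_max_left _ _
  have hvb : v ≤ b := min_le_left _ _
  have huc : u ≤ c := max_le hc.1 (by linarith)
  have hcv : c ≤ v := le_min hc.2 (by linarith)
  have hi : ∀ x y, IntervalIntegrable F MeasureTheory.volume x y := fun x y =>
    hF.intervalIntegrable x y
  rw [← intervalIntegral.integral_add_adjacent_intervals (hi a u) (hi u b),
    ← intervalIntegral.integral_add_adjacent_intervals (hi u v) (hi v b)]
  have hmid : ‖∫ x in u..v, F x‖ ≤ 4 / s := by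
    refine (intervalIntegral.norm_integral_le_of_norm_le_const fun x _ => hF1 x).trans ?_
    rw [one_mul, abs_of_nonneg (by linarith)]
    have h1 : c - 2 / s ≤ u := le_max_right _ _
    have h2 : v ≤ c + 2 / s := min_le_right _ _
    have : 4 / s = 2 / s + 2 / s := by ring
    linarith
  have hAs : 0 ≤ A / s := by positivity
  have hleft : ‖∫ x in a..u, F x‖ ≤ A / s := by
    rcases le_total (c - 2 / s) a with h | h
    · rw [hu, max_eq_left h, intervalIntegral.integral_same, norm_zero]
      exact hAs
    · refine hsub a u hau (Set.Icc_subset_Icc le_rfl (huc.trans hc.2)) fun x hx => ?_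
      refine hgrow x ⟨hx.1, hx.2.trans (huc.trans hc.2)⟩ ?_
      have := hx.2
      rw [hu, max_eq_right h] at this
      rw [abs_sub_comm]
      exact le_trans (by linarith) (le_abs_self _)
  have hright : ‖∫ x in v..b, F x‖ ≤ A / s := by
    rcases le_total b (c + 2 / s) with h | h
    · rw [hv, min_eq_left h, intervalIntegral.integral_same, norm_zero]
      exact hAs
    · refine hsub v b hvb (Set.Icc_subset_Icc (hc.1.trans hcv) le_rfl) fun x hx => ?_
      refine hgrow x ⟨(hc.1.trans hcv).trans hx.1, hx.2⟩ ?_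
      have := hx.1
      rw [hv, min_eq_right h] at this
      exact le_trans (by linarith) (le_abs_self _)
  calc _ ≤ ‖∫ x in a..u, F x‖ + (‖∫ x in u..v, F x‖ + ‖∫ x in v..b, F x‖) :=
        (norm_add_le _ _).trans (by gcongr; exact norm_add_le _ _)
    _ ≤ A / s + (4 / s + A / s) := by gcongr
    _ = _ := by ring

open Polynomial in
/-- The van der Corput estimate for a polynomial phase whose `k`-th derivative, `k ≥ 2`, is bounded
below on the interval of integration. -/
lemma norm_integral_exp_eval_le_of_iterate_derivative (p : ℝ[X]) {s : ℝ} (hs : 0 < s) {k : ℕ}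
    (hk : 2 ≤ k) : ∀ {a b : ℝ}, a ≤ b →
      (∀ x ∈ Set.Icc a b, s ^ k ≤ |(derivative^[k] p).eval x|) →
      ‖∫ x in a..b, Complex.exp (Complex.I * (p.eval x : ℝ))‖ ≤ (4 * 2 ^ k - 4) / s := by
  have hexp : Continuous fun x : ℝ => Complex.exp (Complex.I * (p.eval x : ℝ)) :=
    Complex.continuous_exp.comp
      (continuous_const.mul (Complex.continuous_ofReal.comp p.continuous))
  have hnorm : ∀ x : ℝ, ‖Complex.exp (Complex.I * (p.eval x : ℝ))‖ ≤ 1 := fun x => by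
    rw [mul_comm, Complex.norm_exp_ofReal_mul_I]
  induction k, hk using Nat.le_induction with
  | base =>
    intro a b hab h
    refine (norm_integral_le_of_derivative_ge (A := 4) (m := s) hexp hnorm p.derivative hab hs hs
      (by norm_num) (fun x hx => by simpa [sq] using h x hx) ?_).trans_eq (by norm_num)
    intro u v huv hsub hge
    refine norm_integral_exp_eval_le_of_derivative p huv hs hge fun x hx h0 => ?_
    have := h x (hsub hx)
    simp only [Function.iterate_succ, Function.iterate_zero, Function.comp_apply, id, h0,
      abs_zero] at this
    exact absurd this (not_le.mpr (by positivity))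
  | succ k hk ih =>
    intro a b hab h
    have h2k : (1 : ℝ) ≤ 2 ^ k := one_le_pow₀ (by norm_num)
    refine (norm_integral_le_of_derivative_ge (A := 4 * 2 ^ k - 4) (m := s ^ k) hexp hnorm
      (derivative^[k] p) hab hs (by positivity) (by linarith) (fun x hx => ?_)
      fun u v huv _ hge => ih huv hge).trans_eq (by ring)
    rw [← pow_succ, ← Function.iterate_succ_apply' derivative k p]
    exact h x hx

open Polynomial in
/-- Taylor expansion at a point of the unit interval controls the coefficients of a polynomial by
its derivatives at this point. -/
lemma exists_sum_abs_coeff_le_iterate_derivative (p : ℝ[X]) {d : ℕ} (hd : 0 < d)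
    (hp : p.natDegree ≤ d) {t : ℝ} (ht : t ∈ Set.Icc (0 : ℝ) 1) :
    ∃ k ∈ Finset.Icc 1 d,
      ∑ j ∈ Finset.Icc 1 d, |p.coeff j| ≤ d ^ 2 * |(derivative^[k] p).eval t| := by
  obtain ⟨k, hk, hmax⟩ := Finset.exists_max_image (Finset.Icc 1 d)
    (fun k => |(derivative^[k] p).eval t|) ⟨1, Finset.mem_Icc.mpr ⟨le_rfl, hd⟩⟩
  refine ⟨k, hk, ?_⟩
  set M := |(derivative^[k] p).eval t| with hM
  have hM0 : 0 ≤ M := abs_nonneg _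
  have habs : ∀ (n : ℕ) (x y : ℝ), (n.factorial : ℝ) * x = y → |x| ≤ |y| := by
    intro n x y h
    rw [← h, abs_mul, Nat.abs_cast]
    exact le_mul_of_one_le_left (abs_nonneg x) (by exact_mod_cast n.factorial_pos)
  have hcoeff : ∀ j ∈ Finset.Icc 1 d, |p.coeff j| ≤ d * M := by
    intro j hj
    rw [Finset.mem_Icc] at hj
    set q := derivative^[j] p with hq
    have h0 : (j.factorial : ℝ) * p.coeff j = q.eval 0 := by
      rw [← coeff_zero_eq_eval_zero, hq, coeff_iterate_derivative, zero_add,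
        Nat.descFactorial_self, nsmul_eq_mul]
    have hdeg : (taylor t q).natDegree < d - j + 1 := by
      rw [natDegree_taylor, hq]
      have := natDegree_iterate_derivative p j
      omega
    have h1 : q.eval 0 = ∑ m ∈ Finset.range (d - j + 1), (taylor t q).coeff m * (-t) ^ m := by
      rw [← eval_eq_sum_range' hdeg, taylor_eval, neg_add_cancel]
    refine (habs j _ _ h0).trans ?_
    rw [h1]
    calc _ ≤ ∑ m ∈ Finset.range (d - j + 1), M := by
          refine (Finset.abs_sum_le_sum_abs _ _).trans (Finset.sum_le_sum fun m hm => ?_)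
          rw [Finset.mem_range] at hm
          rw [abs_mul, abs_pow, abs_neg, abs_of_nonneg ht.1, taylor_coeff]
          refine (mul_le_of_le_one_right (abs_nonneg _) (pow_le_one₀ ht.1 ht.2)).trans ?_
          refine (habs m _ ((derivative^[m] q).eval t) ?_).trans ?_
          · rw [← factorial_smul_hasseDeriv, LinearMap.smul_apply, eval_smul, nsmul_eq_mul]
          · rw [hq, ← Function.iterate_add_apply]
            exact hmax (m + j) (Finset.mem_Icc.mpr ⟨by omega, by omega⟩)
      _ = ((d - j + 1 : ℕ) : ℝ) * M := by simp
      _ ≤ d * M := by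
          gcongr
          omega
  calc _ ≤ ∑ j ∈ Finset.Icc 1 d, d * M := Finset.sum_le_sum hcoeff
    _ = _ := by
      rw [Finset.sum_const, Nat.card_Icc, nsmul_eq_mul, Nat.add_sub_cancel]
      ring

open Polynomial in
/-- The derivatives of a polynomial on the unit interval are controlled by its coefficients. -/
lemma abs_eval_iterate_derivative_le (a : ℕ → ℝ) (d k : ℕ) {t : ℝ}
    (ht : t ∈ Set.Icc (0 : ℝ) 1) :
    |(derivative^[k] (∑ j ∈ Finset.Icc 1 d, C (a j) * X ^ j)).eval t| ≤
      d.factorial * ∑ j ∈ Finset.Icc 1 d, |a j| := by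
  rw [iterate_derivative_sum, eval_finsetSum, Finset.mul_sum]
  refine (Finset.abs_sum_le_sum_abs _ _).trans (Finset.sum_le_sum fun j hj => ?_)
  rw [Finset.mem_Icc] at hj
  rw [iterate_derivative_C_mul, iterate_derivative_X_pow_eq_natCast_mul, eval_mul, eval_C, eval_mul,
    eval_natCast, eval_pow, eval_X, abs_mul, abs_mul, Nat.abs_cast, abs_pow, abs_of_nonneg ht.1,
    mul_comm]
  gcongr
  refine (mul_le_of_le_one_right (by positivity) (pow_le_one₀ ht.1 ht.2)).trans ?_
  have : j.descFactorial k ≤ d.factorial := by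
    rcases lt_or_ge j k with h | h
    · rw [Nat.descFactorial_of_lt h]
      exact Nat.zero_le _
    · refine le_trans ?_ (Nat.factorial_le hj.2)
      rw [← Nat.factorial_mul_descFactorial h]
      exact Nat.le_mul_of_pos_left _ (Nat.factorial_pos _)
  exact_mod_cast this

open Polynomial in
/-- The oscillatory integral over a short interval. Here `r ^ d` is the size of the coefficients,
which is comparable to the size of some derivative of the phase throughout the interval. -/
lemma norm_integral_exp_eval_le_of_short (p : ℝ[X]) {d k : ℕ} (hk : k ∈ Finset.Icc 1 d)
    {r B K u v : ℝ} (hr : 1 ≤ r) (hB : 1 ≤ B) (huv : u ≤ v)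
    (hK : ∀ j, 1 ≤ j → ∀ x ∈ Set.Icc u v, |(derivative^[j] p).eval x| ≤ K)
    (hshort : K * (v - u) ≤ r ^ d / B)
    (hu : 2 * (r ^ d / B) ≤ |(derivative^[k] p).eval u|) :
    ‖∫ x in u..v, Complex.exp (Complex.I * (p.eval x : ℝ))‖ ≤ 4 * 2 ^ d * (B / r) := by
  rw [Finset.mem_Icc] at hk
  have hr0 : 0 < r := by linarith
  have hB0 : 0 < B := by linarith
  have hlow : ∀ x ∈ Set.Icc u v, r ^ d / B ≤ |(derivative^[k] p).eval x| := by
    intro x hx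
    have hlip := (convex_Icc u v).norm_image_sub_le_of_norm_hasDerivWithin_le
      (f := fun y => (derivative^[k] p).eval y) (f' := fun y => (derivative^[k + 1] p).eval y)
      (C := K) (x := x) (y := u)
      (fun y _ => by
        rw [Function.iterate_succ_apply']
        exact ((derivative^[k] p).hasDerivAt y).hasDerivWithinAt)
      (fun y hy => hK (k + 1) (by omega) y hy) hx (Set.left_mem_Icc.mpr huv)
    rw [Real.norm_eq_abs, Real.norm_eq_abs, abs_sub_comm u x, abs_of_nonneg (sub_nonneg.mpr hx.1)]
      at hlip
    have hK0 : 0 ≤ K := (abs_nonneg _).trans (hK 1 le_rfl x hx)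
    have h1 : K * (x - u) ≤ K * (v - u) := by
      gcongr
      exact hx.2
    have h2 := abs_sub_abs_le_abs_sub ((derivative^[k] p).eval u) ((derivative^[k] p).eval x)
    linarith
  have hs : 0 < r / B := by positivity
  have h2d : (1 : ℝ) ≤ 2 ^ d := one_le_pow₀ (by norm_num)
  rcases hk.1.eq_or_lt with h1 | h1
  · subst h1
    have hrd : r / B ≤ r ^ d / B := by
      gcongr
      exact le_self_pow₀ hr (by omega)
    refine (norm_integral_exp_eval_le_add p huv hs fun x hx => hrd.trans (hlow x hx)).trans ?_
    have hint : ∫ x in u..v, |p.derivative.derivative.eval x| / (p.derivative.eval x) ^ 2 ≤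
        1 / (r ^ d / B) := by
      have hpos : 0 < r ^ d / B := by positivity
      refine (Real.le_norm_self _).trans ((intervalIntegral.norm_integral_le_of_norm_le_const
        (C := K / (r ^ d / B) ^ 2) fun x hx => ?_).trans ?_)
      · rw [Set.uIoc_of_le huv] at hx
        have hx' := Set.Ioc_subset_Icc_self hx
        rw [Real.norm_eq_abs, abs_div, abs_abs, abs_pow]
        have hK2 := hK 2 (by norm_num) x hx'
        have hl := hlow x hx'
        simp only [Function.iterate_succ, Function.iterate_zero, Function.comp_apply, id] at hK2 hl
        have hK0 : 0 ≤ K := (abs_nonneg _).trans hK2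
        gcongr
      · rw [abs_of_nonneg (sub_nonneg.mpr huv), div_mul_eq_mul_div, div_le_div_iff₀
          (by positivity) hpos]
        nlinarith
    have hle : 1 / (r ^ d / B) ≤ 1 / (r / B) := one_div_le_one_div_of_le hs hrd
    have hBr : 1 / (r / B) = B / r := one_div_div r B
    have hpos : 0 < B / r := by positivity
    have : 2 / (r / B) = 2 * (B / r) := by rw [← hBr]; ring
    nlinarith
  · refine (norm_integral_exp_eval_le_of_iterate_derivative p hs h1 huv fun x hx => ?_).trans ?_
    · refine le_trans ?_ (hlow x hx)
      rw [div_pow]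
      gcongr
      · exact hk.2
      · exact le_self_pow₀ hB (by omega)
    · rw [div_div_eq_mul_div, mul_div_assoc]
      gcongr
      have : (2 : ℝ) ^ k ≤ 2 ^ d := pow_le_pow_right₀ (by norm_num) hk.2
      linarith

/-- **Van der Corput's Lemma.** For every positive integer `d` there exists a constant
`C > 0`, depending only on `d`, such that for every polynomial
`φ(t) = ∑_{k=1}^d a_k t^k` with real coefficients, not all zero, one has
`|∫₀¹ e^{iφ(t)} dt| ≤ C / (∑_{k=1}^d |a_k|)^{1/d}`. -/
theorem van_der_corput_lemma (d : ℕ) (hd : 0 < d) :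
    ∃ C > 0, ∀ a : ℕ → ℝ, (∃ k ∈ Finset.Icc 1 d, a k ≠ 0) →
      ‖∫ t in (0:ℝ)..1, Complex.exp (Complex.I * ((∑ k ∈ Finset.Icc 1 d, a k * t ^ k : ℝ) : ℂ))‖
        ≤ C / (∑ k ∈ Finset.Icc 1 d, |a k|) ^ ((1 : ℝ) / d) := by
  set B : ℝ := 2 * (d : ℝ) ^ 2 with hBdef
  set N : ℕ := d.factorial * (2 * d ^ 2) with hNdef
  have hd1 : (1 : ℝ) ≤ d := by exact_mod_cast hd
  have hB : 1 ≤ B := by nlinarith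
  have hN : 0 < N := by positivity
  have hN1 : (1 : ℝ) ≤ N := by exact_mod_cast hN
  have hNB : (N : ℝ) = d.factorial * B := by
    rw [hNdef, hBdef]
    push_cast
    ring
  have h2d : (1 : ℝ) ≤ 2 ^ d := one_le_pow₀ (by norm_num)
  have hC1 : 1 ≤ N * (4 * 2 ^ d * B) :=
    one_le_mul_of_one_le_of_one_le hN1 (one_le_mul_of_one_le_of_one_le (by linarith) hB)
  refine ⟨N * (4 * 2 ^ d * B), by linarith, fun a ha => ?_⟩
  set L := ∑ k ∈ Finset.Icc 1 d, |a k| with hL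
  have hLpos : 0 < L := by
    obtain ⟨k, hk, hak⟩ := ha
    exact Finset.sum_pos' (fun _ _ => abs_nonneg _) ⟨k, hk, abs_pos.mpr hak⟩
  set r := L ^ ((1 : ℝ) / d) with hr
  have hr0 : 0 < r := Real.rpow_pos_of_pos hLpos _
  have hrd : r ^ d = L := by
    rw [hr, one_div, Real.rpow_inv_natCast_pow hLpos.le hd.ne']
  set p : Polynomial ℝ := ∑ j ∈ Finset.Icc 1 d, Polynomial.C (a j) * Polynomial.X ^ j with hp
  have heval : ∀ t : ℝ, ∑ k ∈ Finset.Icc 1 d, a k * t ^ k = p.eval t := fun t => by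
    simp [hp, Polynomial.eval_finsetSum]
  simp only [heval]
  rcases le_total r 1 with hr1 | hr1
  · refine (intervalIntegral.norm_integral_le_of_norm_le_const (C := 1) fun t _ => ?_).trans ?_
    · rw [mul_comm, Complex.norm_exp_ofReal_mul_I]
    · rw [le_div_iff₀ hr0]
      norm_num
      linarith
  have hcoeff : ∀ j ∈ Finset.Icc 1 d, p.coeff j = a j := fun j hj => by
    simp [hp, Polynomial.coeff_X_pow, Finset.mem_Icc.mp hj]
  have hdeg : p.natDegree ≤ d := Polynomial.natDegree_sum_le_of_forall_le _ _ fun j hj =>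
    (Polynomial.natDegree_C_mul_X_pow_le _ _).trans (Finset.mem_Icc.mp hj).2
  have hexp : Continuous fun x : ℝ => Complex.exp (Complex.I * (p.eval x : ℝ)) :=
    Complex.continuous_exp.comp
      (continuous_const.mul (Complex.continuous_ofReal.comp p.continuous))
  have hsum := intervalIntegral.sum_integral_adjacent_intervals (a := fun i : ℕ => (i : ℝ) / N)
    (n := N) (μ := volume) fun i _ => hexp.intervalIntegrable _ _
  rw [Nat.cast_zero, zero_div, div_self (by positivity)] at hsum
  rw [← hsum]
  calc _ ≤ ∑ i ∈ Finset.range N, 4 * 2 ^ d * (B / r) := by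
        refine (norm_sum_le _ _).trans (Finset.sum_le_sum fun i hi => ?_)
        have hiN : ((i + 1 : ℕ) : ℝ) ≤ N := by exact_mod_cast Finset.mem_range.mp hi
        have hstep : ((i + 1 : ℕ) : ℝ) / N - (i : ℝ) / N = 1 / N := by
          push_cast
          ring
        have hle : (i : ℝ) / N ≤ ((i + 1 : ℕ) : ℝ) / N := by
          gcongr
          omega
        have hsub : Set.Icc ((i : ℝ) / N) (((i + 1 : ℕ) : ℝ) / N) ⊆ Set.Icc 0 1 :=
          Set.Icc_subset_Icc (by positivity) (by rwa [div_le_one (by positivity)])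
        obtain ⟨k, hk, hkle⟩ := exists_sum_abs_coeff_le_iterate_derivative p hd hdeg
          (hsub (Set.left_mem_Icc.mpr hle))
        rw [Finset.sum_congr rfl fun j hj => by rw [hcoeff j hj], ← hL] at hkle
        refine norm_integral_exp_eval_le_of_short p hk hr1 hB hle (K := d.factorial * L)
          (fun j _ x hx => abs_eval_iterate_derivative_le a d j (hsub hx)) ?_ ?_
        · rw [hstep, hNB, hrd]
          have : (d.factorial : ℝ) ≠ 0 := by positivity
          apply le_of_eq
          field_simp
        · rw [hrd, hBdef]
          have : 2 * (L / (2 * (d : ℝ) ^ 2)) = L / d ^ 2 := by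
            field_simp
          rw [this, div_le_iff₀ (by positivity)]
          linarith
    _ = _ := by
        rw [Finset.sum_const, Finset.card_range, nsmul_eq_mul]
        ring
end

section
/- Let φ : ℝ → ℝ be a nonconstant real polynomial. Then ∫₀¹ e^{i λ φ(t)} dt → 0 as λ → ∞. -/
open MeasureTheory Filter

/-- The preimage of a null set under a real function with nonzero strict derivative almost
everywhere is null. -/
theorem quasiMeasurePreserving_of_hasStrictDerivAt {f f' : ℝ → ℝ} (hf : Measurable f)
    (hf' : Measurable f') (hd : ∀ x, HasStrictDerivAt f (f' x) x)
    (h0 : ∀ᵐ x, f' x ≠ 0) : Measure.QuasiMeasurePreserving f volume volume := by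
  refine ⟨hf, Measure.AbsolutelyContinuous.mk fun N hN hN0 => ?_⟩
  rw [Measure.map_apply hf hN]
  have hnull : volume (f ⁻¹' N ∩ {x | f' x ≠ 0}) = 0 := by
    refine measure_null_of_locally_null _ fun x hx => ?_
    obtain ⟨U, hxU, hUo, hU⟩ : ∃ U, x ∈ U ∧ IsOpen U ∧ Set.InjOn f U := by
      have hx' := (hd x).hasStrictFDerivAt_equiv hx.2
      exact ⟨_, hx'.mem_toOpenPartialHomeomorph_source,
        (hx'.toOpenPartialHomeomorph f).open_source, (hx'.toOpenPartialHomeomorph f).injOn⟩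
    set s := f ⁻¹' N ∩ {x | f' x ≠ 0} ∩ U
    have hs : MeasurableSet s :=
      ((hf hN).inter (hf' (measurableSet_singleton 0).compl)).inter hUo.measurableSet
    refine ⟨s, inter_mem_nhdsWithin _ (hUo.mem_nhds hxU), ?_⟩
    have key := lintegral_image_eq_lintegral_abs_deriv_mul hs
      (fun y _ => (hd y).hasDerivAt.hasDerivWithinAt) (hU.mono Set.inter_subset_right) (fun _ => 1)
    have himg : volume (f '' s) = 0 :=
      measure_mono_null (Set.image_subset_iff.2 fun y hy => hy.1.1) hN0
    simp only [lintegral_const, mul_one, one_mul, Measure.restrict_apply_univ, himg] at key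
    by_contra hne
    refine ((setLIntegral_pos_iff (ENNReal.measurable_ofReal.comp hf'.abs)).2 ?_).ne key
    refine lt_of_lt_of_le (pos_iff_ne_zero.2 hne) (measure_mono fun y hy => ⟨?_, hy⟩)
    simpa using hy.1.2
  refine measure_mono_null (fun x hx => ?_) (measure_union_null hnull h0)
  by_cases hx0 : f' x = 0
  · exact Or.inr (by simpa using hx0)
  · exact Or.inl ⟨hx, hx0⟩

/-- The Riemann-Lebesgue lemma for an absolutely continuous finite measure. -/
theorem tendsto_integral_exp_of_absolutelyContinuous (μ : Measure ℝ) [IsFiniteMeasure μ]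
    (hμ : μ ≪ volume) :
    Tendsto (fun lam : ℝ => ∫ y, Complex.exp (Complex.I * ((lam * y : ℝ) : ℂ)) ∂μ)
      atTop (nhds 0) := by
  have hlim : Tendsto (fun lam : ℝ => -(lam / (2 * Real.pi))) atTop (cocompact ℝ) :=
    (tendsto_neg_atTop_atBot.comp
      (tendsto_id.atTop_div_const Real.two_pi_pos)).mono_right atBot_le_cocompact
  refine ((Real.tendsto_integral_exp_smul_cocompact
    fun y => (((μ.rnDeriv volume y).toReal : ℝ) : ℂ)).comp hlim).congr fun lam => ?_
  rw [← integral_rnDeriv_smul hμ]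
  refine integral_congr_ae (ae_of_all _ fun y => ?_)
  simp only [Circle.smul_def, Real.fourierChar_apply, Complex.real_smul, smul_eq_mul]
  rw [mul_comm]
  congr 2
  push_cast
  have : (Real.pi : ℂ) ≠ 0 := by exact_mod_cast Real.pi_ne_zero
  field_simp

/-- If `φ : ℝ → ℝ` is a nonconstant real polynomial, then
`∫₀¹ e^{iλφ(t)} dt → 0` as `λ → ∞`. -/
theorem oscillatory_integral_tendsto_zero (φ : Polynomial ℝ) (hφ : 0 < φ.natDegree) :
    Tendsto (fun lam : ℝ =>
        ∫ t in (0:ℝ)..1, Complex.exp (Complex.I * ((lam * φ.eval t : ℝ) : ℂ)))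
      atTop (nhds 0) := by
  have hder : φ.derivative ≠ 0 := fun h =>
    hφ.ne' (Polynomial.derivative_eq_zero.1 h)
  have hq : Measure.QuasiMeasurePreserving (fun t => φ.eval t) volume volume := by
    refine quasiMeasurePreserving_of_hasStrictDerivAt φ.continuous.measurable
      φ.derivative.continuous.measurable φ.hasStrictDerivAt ?_
    exact (φ.derivative.rootSet_finite ℝ).measure_zero volume |> measure_mono_null fun x hx => by
      simpa [Polynomial.mem_rootSet, hder] using hx
  have hac : (volume.restrict (Set.Ioc (0:ℝ) 1)).map (fun t => φ.eval t) ≪ volume :=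
    (Measure.restrict_le_self.absolutelyContinuous.map hq.measurable).trans hq.absolutelyContinuous
  refine (tendsto_integral_exp_of_absolutelyContinuous _ hac).congr fun lam => ?_
  rw [integral_map hq.measurable.aemeasurable (by fun_prop),
    intervalIntegral.integral_of_le zero_le_one]
end

section
/- Let p : ℝ → ℝ^n be a polynomial curve with p_j(t) = ∑_{k=1}^{d} a_{jk} t^k for j = 1,…,n, where d ≥ n, let A = (a_{jk}) be the n×d coefficient matrix, and let A* be its transpose. Suppose the kernel of A* is trivial over ℚ, i.e., A*ν ≠ 0 for every ν ∈ ℚ^n \ {0}. Then there is a positive constant C, depending only on d (independent of p), such that for all λ > 0 and all ν ∈ ℤ^n \ {0}, |μ̂_λ(ν)| ≤ C / (λ^{1/d} ‖A*ν‖^{1/d}). -/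
open MeasureTheory Finset Real Matrix

open Polynomial in
/-- A real polynomial with no recorded roots inside an interval has constant weak sign on it. -/
lemma Polynomial.eval_nonneg_or_nonpos_of_notMem_roots (R : ℝ[X]) {a b : ℝ} (hab : a < b)
    (h : ∀ x ∈ Set.Ioo a b, x ∉ R.roots) :
    (∀ x ∈ Set.Icc a b, 0 ≤ R.eval x) ∨ (∀ x ∈ Set.Icc a b, R.eval x ≤ 0) := by
  rcases eq_or_ne R 0 with rfl | hR
  · left; simp
  have hne : ∀ x ∈ Set.Ioo a b, R.eval x ≠ 0 := fun x hx h0 =>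
    h x hx ((mem_roots hR).2 h0)
  have hcl : closure (Set.Ioo a b) = Set.Icc a b := closure_Ioo hab.ne
  have key : (∀ x ∈ Set.Ioo a b, 0 ≤ R.eval x) ∨ (∀ x ∈ Set.Ioo a b, R.eval x ≤ 0) := by
    by_contra! hcon
    obtain ⟨⟨x, hx, hx0⟩, y, hy, hy0⟩ := hcon
    have hpre : IsPreconnected (Set.Ioo a b) := isPreconnected_Ioo
    obtain ⟨z, hz, hz0⟩ := hpre.intermediate_value hx hy R.continuous.continuousOn
      ⟨hx0.le, hy0.le⟩
    exact hne z hz hz0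
  rw [← hcl]
  refine key.imp (fun hk => ?_) (fun hk => ?_)
  · exact closure_minimal (t := {x | 0 ≤ R.eval x}) hk
      (isClosed_le continuous_const R.continuous)
  · exact closure_minimal (t := {x | R.eval x ≤ 0}) hk
      (isClosed_le R.continuous continuous_const)

/-- If the integral of `f` over each subinterval avoiding the finite set `S` is bounded by `M`,
then the integral over any subinterval is bounded by `M` times the number of gaps. -/
lemma norm_integral_le_card_mul_of_gaps {E : Type*} [NormedAddCommGroup E] [NormedSpace ℝ E]
    {f : ℝ → E} (hf : Continuous f) (S : Finset ℝ) {M u v : ℝ} (hM : 0 ≤ M)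
    (h : ∀ a b, u ≤ a → a < b → b ≤ v → (∀ x ∈ Set.Ioo a b, x ∉ S) →
      ‖∫ t in a..b, f t‖ ≤ M) (huv : u < v) :
    ‖∫ t in u..v, f t‖ ≤ (S.card + 1) * M := by
  classical
  induction hn : S.card using Nat.strong_induction_on generalizing S u v with
  | _ n ih =>
    subst hn
    by_cases hS : ∀ x ∈ Set.Ioo u v, x ∉ S
    · have h1 := h u v le_rfl huv le_rfl hS
      have : 0 ≤ (S.card : ℝ) * M := by positivity
      linarith
    push Not at hS
    obtain ⟨c, hc, hcS⟩ := hS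
    set S₁ := S.filter (· < c)
    set S₂ := S.filter (c < ·)
    have hdisj : Disjoint S₁ S₂ := by
      rw [Finset.disjoint_left]
      intro x hx hx'
      exact lt_asymm (mem_filter.1 hx).2 (mem_filter.1 hx').2
    have hlt : S₁.card + S₂.card + 1 ≤ S.card := by
      rw [← card_union_of_disjoint hdisj]
      refine Finset.card_lt_card (Finset.ssubset_iff_of_subset ?_ |>.2 ⟨c, hcS, ?_⟩)
      · exact union_subset (filter_subset _ _) (filter_subset _ _)
      · simp [S₁, S₂]
    have h1 := ih S₁.card (by omega) S₁ (u := u) (v := c) (fun a b ha hab hb hx =>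
      h a b ha hab (hb.trans hc.2.le) fun x hxab hxS =>
        hx x hxab (mem_filter.2 ⟨hxS, hxab.2.trans_le hb⟩)) hc.1 rfl
    have h2 := ih S₂.card (by omega) S₂ (u := c) (v := v) (fun a b ha hab hb hx =>
      h a b (hc.1.le.trans ha) hab hb fun x hxab hxS =>
        hx x hxab (mem_filter.2 ⟨hxS, ha.trans_lt hxab.1⟩)) hc.2 rfl
    rw [← intervalIntegral.integral_add_adjacent_intervals (hf.intervalIntegrable u c)
      (hf.intervalIntegrable c v)]
    have hlt' : (S₁.card + S₂.card + 1 : ℝ) ≤ S.card := by exact_mod_cast hlt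
    calc _ ≤ _ := norm_add_le _ _
      _ ≤ (S₁.card + 1) * M + (S₂.card + 1) * M := add_le_add h1 h2
      _ = (S₁.card + S₂.card + 1 + 1) * M := by ring
      _ ≤ _ := by gcongr

open Polynomial in
/-- First-derivative van der Corput estimate for a polynomial phase. -/
lemma norm_integral_exp_le_of_le_abs_derivative (P : ℝ[X]) {a b α : ℝ} (hab : a ≤ b)
    (hα : 0 < α) (hQ : ∀ x ∈ Set.Icc a b, α ≤ |P.derivative.eval x|)
    (hmono : (∀ x ∈ Set.Icc a b, 0 ≤ P.derivative.derivative.eval x) ∨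
      (∀ x ∈ Set.Icc a b, P.derivative.derivative.eval x ≤ 0)) :
    ‖∫ t in a..b, Complex.exp (Complex.I * (P.eval t : ℝ))‖ ≤ 4 / α := by
  set Q := P.derivative with hQdef
  have hQ0 : ∀ x ∈ Set.Icc a b, Q.eval x ≠ 0 := fun x hx h0 => by
    have := hQ x hx
    rw [h0, abs_zero] at this
    linarith
  have hinv : ∀ x ∈ Set.Icc a b, |(Q.eval x)⁻¹| ≤ α⁻¹ := fun x hx => by
    rw [abs_inv]
    exact inv_anti₀ hα (hQ x hx)
  have huIcc : Set.uIcc a b = Set.Icc a b := Set.uIcc_of_le hab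
  have hu : ∀ x ∈ Set.uIcc a b, HasDerivAt (fun t => (Q.eval t)⁻¹)
      (-Q.derivative.eval x / (Q.eval x) ^ 2) x := fun x hx =>
    (Q.hasDerivAt x).inv (hQ0 x (huIcc ▸ hx))
  have hv : ∀ x ∈ Set.uIcc a b, HasDerivAt
      (fun t : ℝ => -Complex.I * Complex.exp (Complex.I * (P.eval t : ℝ)))
      (((Q.eval x : ℝ) : ℂ) * Complex.exp (Complex.I * (P.eval x : ℝ))) x := fun x _ => by
    have h := ((((P.hasDerivAt x).ofReal_comp).const_mul Complex.I).cexp).const_mul (-Complex.I)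
    refine h.congr_deriv ?_
    linear_combination (-((Q.eval x : ℝ) : ℂ) * Complex.exp (Complex.I * (P.eval x : ℝ))) *
      Complex.I_mul_I
  have hcu : ContinuousOn (fun x => -Q.derivative.eval x / (Q.eval x) ^ 2) (Set.uIcc a b) :=
    (Q.derivative.continuous.neg.continuousOn).div (Q.continuous.pow 2).continuousOn
      fun x hx => pow_ne_zero 2 (hQ0 x (huIcc ▸ hx))
  have hcv : Continuous (fun x : ℝ => ((Q.eval x : ℝ) : ℂ) * Complex.exp (Complex.I * (P.eval x : ℝ))) := by
    have := Q.continuous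
    have := P.continuous
    fun_prop
  have hparts := intervalIntegral.integral_mul_deriv_eq_deriv_mul
    (fun x hx => (hu x hx).ofReal_comp) hv
    ((Complex.continuous_ofReal.comp_continuousOn hcu).intervalIntegrable)
    (hcv.intervalIntegrable a b)
  have hftc := intervalIntegral.integral_eq_sub_of_hasDerivAt hu hcu.intervalIntegrable
  have hlhs : ∫ t in a..b, Complex.exp (Complex.I * (P.eval t : ℝ)) =
      ∫ x in a..b, (((Q.eval x)⁻¹ : ℝ) : ℂ) *
        (((Q.eval x : ℝ) : ℂ) * Complex.exp (Complex.I * (P.eval x : ℝ))) := by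
    refine intervalIntegral.integral_congr fun x hx => ?_
    have : ((Q.eval x : ℝ) : ℂ) ≠ 0 := by exact_mod_cast hQ0 x (huIcc ▸ hx)
    simp only [Complex.ofReal_inv]
    field_simp
  have hnorm : ∀ x : ℝ, ‖-Complex.I * Complex.exp (Complex.I * (P.eval x : ℝ))‖ = 1 := fun x => by
    rw [mul_comm Complex.I, norm_mul, Complex.norm_exp_ofReal_mul_I]
    simp
  have hA := abs_le.1 (hinv a ⟨le_rfl, hab⟩)
  have hB := abs_le.1 (hinv b ⟨hab, le_rfl⟩)
  have hint : ∫ x in a..b, |(-Q.derivative.eval x / (Q.eval x) ^ 2)| ≤ 2 * α⁻¹ := by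
    rcases hmono with hm | hm
    · have : ∫ x in a..b, |(-Q.derivative.eval x / (Q.eval x) ^ 2)| =
          ∫ x in a..b, -(-Q.derivative.eval x / (Q.eval x) ^ 2) :=
        intervalIntegral.integral_congr fun x hx => abs_of_nonpos <|
          div_nonpos_of_nonpos_of_nonneg (neg_nonpos.2 (hm x (huIcc ▸ hx))) (sq_nonneg _)
      rw [this, intervalIntegral.integral_neg, hftc]
      linarith
    · have : ∫ x in a..b, |(-Q.derivative.eval x / (Q.eval x) ^ 2)| =
          ∫ x in a..b, (-Q.derivative.eval x / (Q.eval x) ^ 2) :=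
        intervalIntegral.integral_congr fun x hx => abs_of_nonneg <|
          div_nonneg (neg_nonneg.2 (hm x (huIcc ▸ hx))) (sq_nonneg _)
      rw [this, hftc]
      linarith
  have hrem : ‖∫ x in a..b, ((-Q.derivative.eval x / (Q.eval x) ^ 2 : ℝ) : ℂ) *
      (-Complex.I * Complex.exp (Complex.I * (P.eval x : ℝ)))‖ ≤ 2 * α⁻¹ := by
    refine (intervalIntegral.norm_integral_le_integral_norm hab).trans (le_trans (le_of_eq ?_) hint)
    refine intervalIntegral.integral_congr fun x _ => ?_
    simp only [norm_mul _ (-Complex.I * _), hnorm, mul_one, Complex.norm_real, Real.norm_eq_abs]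
  have hend : ∀ x ∈ Set.Icc a b, ‖(((Q.eval x)⁻¹ : ℝ) : ℂ) *
      (-Complex.I * Complex.exp (Complex.I * (P.eval x : ℝ)))‖ ≤ α⁻¹ := fun x hx => by
    rw [norm_mul, hnorm, mul_one, Complex.norm_real]
    exact hinv x hx
  rw [hlhs, hparts]
  calc _ ≤ _ := norm_sub_le _ _
    _ ≤ (α⁻¹ + α⁻¹) + 2 * α⁻¹ := add_le_add ((norm_sub_le _ _).trans
        (add_le_add (hend b ⟨hab, le_rfl⟩) (hend a ⟨le_rfl, hab⟩))) hrem
    _ = 4 / α := by ring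

open Polynomial in
/-- The coefficients of a polynomial of degree at most `D` are controlled by its values on
`[0, 1]`. -/
lemma exists_sum_abs_coeff_le (D : ℕ) : ∃ K > 0, ∀ (Q : ℝ[X]), Q.natDegree ≤ D → ∀ s : ℝ,
    (∀ y ∈ Set.Icc (0 : ℝ) 1, |Q.eval y| ≤ s) →
    ∑ k : Fin (D + 1), |Q.coeff k| ≤ K * s := by
  set y : Fin (D + 1) → ℝ := fun j => (j : ℝ) / (D + 1) with hy
  have hyinj : Function.Injective y := fun i j hij => by
    have hD : (D + 1 : ℝ) ≠ 0 := by positivity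
    have : (i : ℝ) = j := by simpa [hy, div_left_inj' hD] using hij
    exact Fin.ext (by exact_mod_cast this)
  have hymem : ∀ j, y j ∈ Set.Icc (0 : ℝ) 1 := fun j => by
    refine ⟨by positivity, (div_le_one (by positivity)).2 ?_⟩
    exact_mod_cast j.2.le
  set V := Matrix.vandermonde y with hV
  have hdet : IsUnit V.det := (Matrix.det_vandermonde_ne_zero_iff.2 hyinj).isUnit
  refine ⟨1 + ∑ k, ∑ j, |V⁻¹ k j|, by positivity, fun Q hQ s hs => ?_⟩
  have hs0 : 0 ≤ s := (abs_nonneg _).trans (hs 0 (by simp))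
  have hmul : V.mulVec (fun k => Q.coeff k) = fun j => Q.eval (y j) := by
    ext j
    rw [Polynomial.eval_eq_sum_range' (Nat.lt_succ_of_le hQ), Finset.sum_range]
    simp [Matrix.mulVec, dotProduct, hV, Matrix.vandermonde_apply, mul_comm]
  have hcoeff : ∀ k : Fin (D + 1), Q.coeff k = ∑ j, V⁻¹ k j * Q.eval (y j) := fun k => by
    have := congrFun (congrArg V⁻¹.mulVec hmul) k
    rw [Matrix.mulVec_mulVec, Matrix.nonsing_inv_mul _ hdet, Matrix.one_mulVec] at this
    exact this
  calc ∑ k : Fin (D + 1), |Q.coeff k| ≤ ∑ k, ∑ j, |V⁻¹ k j| * s := by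
        refine Finset.sum_le_sum fun k _ => ?_
        rw [hcoeff k]
        refine (Finset.abs_sum_le_sum_abs _ _).trans (Finset.sum_le_sum fun j _ => ?_)
        rw [abs_mul]
        exact mul_le_mul_of_nonneg_left (hs _ (hymem j)) (abs_nonneg _)
    _ = (∑ k, ∑ j, |V⁻¹ k j|) * s := by simp only [Finset.sum_mul]
    _ ≤ _ := by linarith

open Polynomial in
/-- Lagrange interpolation: smallness of a polynomial on a subinterval of `[0, 1]` propagates to
all of `[0, 1]`. -/
lemma pow_mul_abs_eval_le_of_abs_eval_le {D : ℕ} {Q : ℝ[X]} (hQ : Q.natDegree ≤ D)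
    {a b α : ℝ} (ha : 0 ≤ a) (hab : a < b) (hb : b ≤ 1)
    (hα : ∀ x ∈ Set.Icc a b, |Q.eval x| ≤ α) {y : ℝ} (hy : y ∈ Set.Icc (0 : ℝ) 1) :
    (b - a) ^ D * |Q.eval y| ≤ (D + 1) ^ (D + 1) * α := by
  have hD : (0 : ℝ) < D + 1 := by positivity
  have hba : 0 < b - a := sub_pos.2 hab
  set x : Fin (D + 1) → ℝ := fun j => a + (b - a) * ((j : ℝ) / (D + 1)) with hx
  have hxmem : ∀ j, x j ∈ Set.Icc a b := fun j => by
    have h1 : 0 ≤ (j : ℝ) / (D + 1) := by positivity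
    have h2 : (j : ℝ) / (D + 1) ≤ 1 := (div_le_one hD).2 (by exact_mod_cast j.2.le)
    constructor <;> simp only [hx] <;> nlinarith
  have hsep : ∀ i j, i ≠ j → (b - a) / (D + 1) ≤ |x i - x j| := fun i j hij => by
    have h1 : x i - x j = (b - a) / (D + 1) * (((i : ℤ) - (j : ℤ) : ℤ) : ℝ) := by
      simp only [hx]; push_cast; ring
    have h2 : (1 : ℝ) ≤ |(((i : ℤ) - (j : ℤ) : ℤ) : ℝ)| := by
      have : (i : ℤ) - (j : ℤ) ≠ 0 := by
        intro h; exact hij (Fin.ext (by omega))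
      exact_mod_cast Int.one_le_abs this
    rw [h1, abs_mul, abs_of_pos (div_pos hba hD)]
    exact le_mul_of_one_le_right (div_pos hba hD).le h2
  have hinj : Set.InjOn x (Finset.univ : Finset (Fin (D + 1))) := fun i _ j _ hij => by
    by_contra hne
    have := hsep i j hne
    rw [hij, sub_self, abs_zero] at this
    exact absurd this (not_le.2 (div_pos hba hD))
  have hdeg : Q.degree < (Finset.univ : Finset (Fin (D + 1))).card := by
    rw [Finset.card_univ, Fintype.card_fin]
    exact (Polynomial.degree_le_of_natDegree_le hQ).trans_lt (by exact_mod_cast Nat.lt_succ_self D)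
  have hα0 : 0 ≤ α := (abs_nonneg _).trans (hα a ⟨le_rfl, hab.le⟩)
  have hbasis : ∀ i, (b - a) ^ D * |(Lagrange.basis Finset.univ x i).eval y| ≤ (D + 1) ^ D := by
    intro i
    have hcard : (Finset.univ.erase i).card = D := by simp
    have hpow : (b - a) ^ D = ∏ _j ∈ Finset.univ.erase i, (b - a) := by
      rw [Finset.prod_const, hcard]
    rw [Lagrange.basis, Polynomial.eval_prod, Finset.abs_prod, hpow, ← Finset.prod_mul_distrib]
    calc _ ≤ ∏ _j ∈ Finset.univ.erase i, (D + 1 : ℝ) := by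
          refine Finset.prod_le_prod (fun j _ => by positivity) fun j hj => ?_
          have hij : i ≠ j := (Finset.ne_of_mem_erase hj).symm
          have h1 := hsep i j hij
          have h3 : 0 < |x i - x j| := (div_pos hba hD).trans_le h1
          have h2 : |y - x j| ≤ 1 := by
            have := hxmem j
            rw [abs_le]; constructor <;> linarith [this.1, this.2, hy.1, hy.2]
          simp only [Lagrange.basisDivisor, eval_mul, eval_C, eval_sub, eval_X, abs_mul, abs_inv]
          rw [div_le_iff₀ hD] at h1
          calc (b - a) * (|x i - x j|⁻¹ * |y - x j|)
              ≤ (|x i - x j| * (D + 1)) * (|x i - x j|⁻¹ * 1) := by gcongr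
            _ = D + 1 := by field_simp
      _ = (D + 1) ^ D := by rw [Finset.prod_const, hcard]
  rw [Lagrange.eq_interpolate hinj hdeg, Lagrange.interpolate_apply, Polynomial.eval_finsetSum]
  calc _ ≤ (b - a) ^ D * ∑ i, |(C (Q.eval (x i)) * Lagrange.basis Finset.univ x i).eval y| := by
        gcongr; exact Finset.abs_sum_le_sum_abs _ _
    _ = ∑ i, |Q.eval (x i)| * ((b - a) ^ D * |(Lagrange.basis Finset.univ x i).eval y|) := by
        rw [Finset.mul_sum]
        refine Finset.sum_congr rfl fun i _ => ?_
        rw [eval_mul, eval_C, abs_mul]; ring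
    _ ≤ ∑ _i : Fin (D + 1), α * (D + 1 : ℝ) ^ D := by
        refine Finset.sum_le_sum fun i _ => ?_
        exact mul_le_mul (hα _ (hxmem i)) (hbasis i) (by positivity) hα0
    _ = _ := by
        rw [Finset.sum_const, Finset.card_univ, Fintype.card_fin, nsmul_eq_mul]; push_cast; ring

open Polynomial in
/-- Uniform decay of oscillatory integrals on `[0, 1]` with polynomial phase of bounded degree. -/
lemma exists_norm_integral_exp_polynomial_le (D : ℕ) : ∃ K > 0, ∀ P : ℝ[X],
    P.natDegree ≤ D + 1 → ∀ β : ℝ, 0 < β →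
    1 ≤ β ^ (D + 1) * ∑ k : Fin (D + 1), |P.derivative.coeff k| →
    ‖∫ t in (0 : ℝ)..1, Complex.exp (Complex.I * (P.eval t : ℝ))‖ ≤ K * β := by
  classical
  obtain ⟨K, hK, hcoeff⟩ := exists_sum_abs_coeff_le D
  set M : ℝ := K * (D + 1) ^ (D + 1) with hM
  have hM0 : 0 < M := by positivity
  refine ⟨(3 * D + 1) * (1 + 8 * M), by positivity, fun P hP β hβ hB => ?_⟩
  set Q := P.derivative with hQdef
  have hQ : Q.natDegree ≤ D := (natDegree_derivative_le P).trans (by omega)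
  set α : ℝ := 1 / (2 * M * β) with hαdef
  have hα : 0 < α := by positivity
  set R : ℝ[X] := Q ^ 2 - C (α ^ 2) with hR
  set S : Finset ℝ := (Q.derivative.roots + R.roots).toFinset with hS
  have hScard : S.card ≤ 3 * D := by
    have h1 : Q.derivative.natDegree ≤ D := (natDegree_derivative_le Q).trans (by omega)
    have h2 : R.natDegree ≤ 2 * D := by
      rw [hR, natDegree_sub_C]
      exact natDegree_pow_le.trans (by omega)
    calc S.card ≤ (Q.derivative.roots + R.roots).card := Multiset.toFinset_card_le _
      _ ≤ _ := by
        rw [Multiset.card_add]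
        have := Q.derivative.card_roots'
        have := R.card_roots'
        omega
  have hcont : Continuous fun t : ℝ => Complex.exp (Complex.I * (P.eval t : ℝ)) := by
    have := P.continuous
    fun_prop
  have hgap : ∀ a b : ℝ, 0 ≤ a → a < b → b ≤ 1 → (∀ x ∈ Set.Ioo a b, x ∉ S) →
      ‖∫ t in a..b, Complex.exp (Complex.I * (P.eval t : ℝ))‖ ≤ (1 + 8 * M) * β := by
    intro a b ha hab hb hx
    have hQ' := Q.derivative.eval_nonneg_or_nonpos_of_notMem_roots hab fun x hxab hxr =>
      hx x hxab (Multiset.mem_toFinset.2 (Multiset.mem_add.2 (Or.inl hxr)))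
    rcases R.eval_nonneg_or_nonpos_of_notMem_roots hab fun x hxab hxr =>
      hx x hxab (Multiset.mem_toFinset.2 (Multiset.mem_add.2 (Or.inr hxr))) with hlarge | hsmall
    · refine (norm_integral_exp_le_of_le_abs_derivative P hab.le hα (fun x hxm => ?_) hQ').trans ?_
      · have := hlarge x hxm
        simp only [hR, eval_sub, eval_pow, eval_C, sub_nonneg] at this
        exact le_of_sq_le_sq (by rwa [sq_abs]) (abs_nonneg _)
      · have : 4 / α = 8 * M * β := by rw [hαdef]; field_simp; ring
        rw [this]; nlinarith
    · have hle : ∀ x ∈ Set.Icc a b, |Q.eval x| ≤ α := fun x hxm => by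
        have := hsmall x hxm
        simp only [hR, eval_sub, eval_pow, eval_C, sub_nonpos] at this
        exact abs_le_of_sq_le_sq this hα.le
      have hba : 0 < b - a := sub_pos.2 hab
      have hsum := hcoeff Q hQ (((D + 1) ^ (D + 1) * α) / (b - a) ^ D) fun y hy => by
        rw [le_div_iff₀ (by positivity), mul_comm]
        exact pow_mul_abs_eval_le_of_abs_eval_le hQ ha hab hb hle hy
      have hpow : (b - a) ^ D ≤ β ^ D / 2 := by
        have h1 : 1 ≤ β ^ (D + 1) * (K * (((D + 1) ^ (D + 1) * α) / (b - a) ^ D)) :=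
          hB.trans (by gcongr)
        have h2 : β ^ (D + 1) * (K * (((D + 1) ^ (D + 1) * α) / (b - a) ^ D)) =
            (β ^ D / 2) / (b - a) ^ D := by
          rw [hαdef, hM]; field_simp; ring
        rw [h2, le_div_iff₀ (by positivity), one_mul] at h1
        exact h1
      have hlen : b - a ≤ β := by
        by_contra! hcon
        have h3 : β ^ D ≤ (b - a) ^ D := by gcongr
        have h4 : 0 < β ^ D := by positivity
        linarith
      have h5 := intervalIntegral.norm_integral_le_of_norm_le_const (a := a) (b := b) (C := 1)
        (f := fun t : ℝ => Complex.exp (Complex.I * (P.eval t : ℝ))) fun x _ => by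
          rw [mul_comm, Complex.norm_exp_ofReal_mul_I]
      rw [one_mul, abs_of_pos hba] at h5
      have : 0 < M * β := by positivity
      linarith
  have hfin := norm_integral_le_card_mul_of_gaps hcont S (by positivity) hgap zero_lt_one
  refine hfin.trans ?_
  have : (S.card : ℝ) ≤ 3 * D := by exact_mod_cast hScard
  rw [mul_assoc]
  gcongr

/-- Let `p : ℝ → ℝ^n` be the polynomial curve `p_j(t) = ∑_{k=1}^d a_{jk} t^k` with `d ≥ n` and
coefficient matrix `A = (a_{jk})`. If the kernel of the transpose `A*` is trivial over `ℚ`, then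
there is a constant `C > 0` depending only on `d` (independent of `p`) such that for all `λ > 0`
and all `ν ∈ ℤ^n \ {0}`, the Fourier coefficient
`μ̂_λ(ν) = ∫₀¹ e^{2πiλ⟨ν, p(t)⟩} dt` satisfies
`|μ̂_λ(ν)| ≤ C / (λ^{1/d} ‖A*ν‖^{1/d})`, with `‖·‖` the `ℓ¹`-norm. -/
theorem fourier_decay_rational_kernel (d : ℕ) (hd : 0 < d) :
    ∃ C > 0, ∀ (n : ℕ), n ≤ d → ∀ A : Matrix (Fin n) (Fin d) ℝ,
      (∀ ν : Fin n → ℚ, ν ≠ 0 → Aᵀ.mulVec (fun j => (ν j : ℝ)) ≠ 0) →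
      ∀ lam : ℝ, 0 < lam → ∀ ν : Fin n → ℤ, ν ≠ 0 →
        ‖∫ t in (0:ℝ)..1, Complex.exp (2 * π * Complex.I *
            ((lam * ∑ j, (ν j : ℝ) * ∑ k : Fin d, A j k * t ^ ((k : ℕ) + 1) : ℝ) : ℂ))‖
          ≤ C / (lam ^ ((1:ℝ)/d) *
              (∑ k : Fin d, |Aᵀ.mulVec (fun j => ((ν j : ℤ) : ℝ)) k|) ^ ((1:ℝ)/d)) := by
  obtain ⟨D, rfl⟩ : ∃ D, d = D + 1 := ⟨d - 1, by omega⟩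
  obtain ⟨K, hK, hmain⟩ := exists_norm_integral_exp_polynomial_le D
  refine ⟨K, hK, fun n _ A hA lam hlam ν hν => ?_⟩
  set b : Fin (D + 1) → ℝ := Aᵀ.mulVec (fun j => ((ν j : ℤ) : ℝ)) with hb
  have hb0 : b ≠ 0 := by
    have h := hA (fun j => (ν j : ℚ)) fun h0 => hν (funext fun j => by
      simpa using congrFun h0 j)
    simpa [hb] using h
  have hsum : 0 < ∑ k, |b k| := by
    obtain ⟨k, hk⟩ := Function.ne_iff.1 hb0
    exact Finset.sum_pos' (fun _ _ => abs_nonneg _) ⟨k, mem_univ k, abs_pos.2 hk⟩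
  set B : ℝ := lam * ∑ k, |b k| with hB
  have hB0 : 0 < B := mul_pos hlam hsum
  set P : Polynomial ℝ := ∑ k : Fin (D + 1),
    Polynomial.C (2 * π * lam * b k) * Polynomial.X ^ ((k : ℕ) + 1) with hP
  have hdeg : P.natDegree ≤ D + 1 :=
    Polynomial.natDegree_sum_le_of_forall_le _ _ fun k _ =>
      (Polynomial.natDegree_C_mul_X_pow_le _ _).trans (by omega)
  have hcoeff : ∀ k : Fin (D + 1),
      P.derivative.coeff k = 2 * π * lam * b k * ((k : ℕ) + 1) := fun k => by
    rw [Polynomial.coeff_derivative, hP, Polynomial.finsetSum_coeff]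
    congr 1
    rw [Finset.sum_eq_single k]
    · rw [Polynomial.coeff_C_mul_X_pow, if_pos rfl]
    · intro j _ hj
      have : (k : ℕ) ≠ j := fun h => hj (Fin.ext h.symm)
      rw [Polynomial.coeff_C_mul_X_pow, if_neg (by omega)]
    · simp
  have hBle : B ≤ ∑ k : Fin (D + 1), |P.derivative.coeff k| := by
    rw [hB, Finset.mul_sum]
    refine Finset.sum_le_sum fun k _ => ?_
    rw [hcoeff, abs_mul, abs_mul, abs_of_pos (by positivity : 0 < 2 * π * lam),
      abs_of_pos (by positivity : (0 : ℝ) < (k : ℕ) + 1)]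
    have h1 : (1 : ℝ) ≤ (k : ℕ) + 1 := by simp
    have h2 : lam ≤ 2 * π * lam := le_mul_of_one_le_left hlam.le (by linarith [pi_gt_three])
    calc lam * |b k| ≤ 2 * π * lam * |b k| := by gcongr
      _ ≤ _ := le_mul_of_one_le_right (by positivity) h1
  set γ : ℝ := B ^ ((1 : ℝ) / ((D + 1 : ℕ) : ℝ)) with hγ
  have hγ0 : 0 < γ := Real.rpow_pos_of_pos hB0 _
  have hγpow : γ ^ (D + 1) = B := by
    rw [hγ, one_div]
    exact Real.rpow_inv_natCast_pow hB0.le (by omega)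
  have hbound := hmain P hdeg γ⁻¹ (inv_pos.2 hγ0) (by
    rw [inv_pow, hγpow, inv_mul_eq_div]
    exact (one_le_div hB0).2 hBle)
  have heval : ∀ t : ℝ, P.eval t = 2 * π *
      (lam * ∑ j, (ν j : ℝ) * ∑ k : Fin (D + 1), A j k * t ^ ((k : ℕ) + 1)) := fun t => by
    simp only [hP, Polynomial.eval_finsetSum, Polynomial.eval_mul, Polynomial.eval_C,
      Polynomial.eval_pow, Polynomial.eval_X, hb, Matrix.mulVec, dotProduct,
      Matrix.transpose_apply, Finset.mul_sum, Finset.sum_mul]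
    rw [Finset.sum_comm]
    refine Finset.sum_congr rfl fun j _ => Finset.sum_congr rfl fun k _ => ?_
    ring
  rw [← Real.mul_rpow hlam.le hsum.le, div_eq_mul_inv]
  refine le_of_eq_of_le (congrArg norm ?_) hbound
  refine intervalIntegral.integral_congr fun t _ => ?_
  simp only [heval]
  congr 1
  push_cast
  ring
end

section
/- Let p : ℝ → ℝ^n be a polynomial curve with p_j(t) = ∑_{k=1}^{d} a_{jk} t^k for j = 1,…,n, where d ≥ n, let A = (a_{jk}) be the n×d coefficient matrix, and let A* be its transpose. Suppose the kernel of A* is trivial over ℝ, i.e., A*x ≠ 0 for every x ∈ ℝ^n \ {0}. Then there is a positive constant C such that for all λ > 0, sup_{ν ∈ ℤ^n \ {0}} ‖ν‖^{1/d} |μ̂_λ(ν)| ≤ C / λ^{1/d}. -/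
open MeasureTheory Finset Real Matrix

/-- The oscillatory integral `∫_a^b e^{i f(t)} dt` with polynomial phase `f`. -/
noncomputable def oscillatoryIntegral (f : Polynomial ℝ) (a b : ℝ) : ℂ :=
  ∫ t in a..b, Complex.exp (Complex.I * (f.eval t : ℝ))

theorem continuous_exp_I_mul_eval (f : Polynomial ℝ) :
    Continuous fun t : ℝ => Complex.exp (Complex.I * (f.eval t : ℝ)) := by
  have := f.continuous
  fun_prop

theorem oscillatoryIntegral_add_adjacent (f : Polynomial ℝ) (a b c : ℝ) :
    oscillatoryIntegral f a b + oscillatoryIntegral f b c = oscillatoryIntegral f a c :=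
  intervalIntegral.integral_add_adjacent_intervals
    ((continuous_exp_I_mul_eval f).intervalIntegrable _ _)
    ((continuous_exp_I_mul_eval f).intervalIntegrable _ _)

theorem norm_oscillatoryIntegral_le_sub (f : Polynomial ℝ) {a b : ℝ} (hab : a ≤ b) :
    ‖oscillatoryIntegral f a b‖ ≤ b - a := by
  have := intervalIntegral.norm_integral_le_of_norm_le_const (a := a) (b := b) (C := 1)
    (f := fun t : ℝ => Complex.exp (Complex.I * (f.eval t : ℝ)))
    fun x _ => (Complex.norm_exp_I_mul_ofReal _).le
  rwa [one_mul, abs_of_nonneg (sub_nonneg.2 hab)] at this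

/-- Integration by parts: the first derivative test with explicit total variation term. -/
theorem norm_oscillatoryIntegral_le_add_integral (f : Polynomial ℝ) {a b μ : ℝ} (hab : a ≤ b)
    (hμ : 0 < μ) (h : ∀ t ∈ Set.Icc a b, μ ≤ |f.derivative.eval t|) :
    ‖oscillatoryIntegral f a b‖ ≤
      2 / μ + ∫ t in a..b, |f.derivative.derivative.eval t| / (f.derivative.eval t) ^ 2 := by
  have hne : ∀ t ∈ Set.Icc a b, f.derivative.eval t ≠ 0 := fun t ht h0 => by
    have := h t ht
    rw [h0, abs_zero] at this
    linarith
  have hI : Set.uIcc a b = Set.Icc a b := Set.uIcc_of_le hab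
  set e : ℝ → ℂ := fun t => Complex.exp (Complex.I * (f.eval t : ℝ)) with he
  set u : ℝ → ℂ := fun t => -Complex.I * (((f.derivative.eval t)⁻¹ : ℝ) : ℂ) with hu
  set u' : ℝ → ℂ := fun t => -Complex.I *
    ((-(f.derivative.derivative.eval t) / (f.derivative.eval t) ^ 2 : ℝ) : ℂ) with hu'
  set e' : ℝ → ℂ := fun t => e t * (Complex.I * (f.derivative.eval t : ℝ)) with he'
  have hec : Continuous e := continuous_exp_I_mul_eval f
  have hude : ∀ t ∈ Set.uIcc a b, HasDerivAt u (u' t) t := fun t ht =>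
    (((f.derivative.hasDerivAt t).inv (hne t (hI ▸ ht))).ofReal_comp).const_mul _
  have hede : ∀ t ∈ Set.uIcc a b, HasDerivAt e (e' t) t := fun t _ =>
    (((f.hasDerivAt t).ofReal_comp).const_mul Complex.I).cexp
  have hquot : ContinuousOn
      (fun t => -(f.derivative.derivative.eval t) / (f.derivative.eval t) ^ 2) (Set.Icc a b) :=
    (f.derivative.derivative.continuous.neg.continuousOn).div
      (f.derivative.continuous.pow 2).continuousOn fun t ht => pow_ne_zero 2 (hne t ht)
  have hu'c : ContinuousOn u' (Set.uIcc a b) := by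
    rw [hI]
    exact continuousOn_const.mul (Complex.continuous_ofReal.comp_continuousOn hquot)
  have he'c : Continuous e' :=
    hec.mul (continuous_const.mul (Complex.continuous_ofReal.comp f.derivative.continuous))
  have hparts := intervalIntegral.integral_mul_deriv_eq_deriv_mul hude hede
    hu'c.intervalIntegrable (he'c.intervalIntegrable _ _)
  have hosc : oscillatoryIntegral f a b = ∫ t in a..b, u t * e' t := by
    refine intervalIntegral.integral_congr fun t ht => ?_
    have h0 : ((f.derivative.eval t : ℝ) : ℂ) ≠ 0 := by
      exact_mod_cast hne t (hI ▸ ht)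
    simp only [hu, he', he, Complex.ofReal_inv]
    field_simp
    simp
  have hen : ∀ t, ‖e t‖ = 1 := fun t => Complex.norm_exp_I_mul_ofReal _
  have hun : ∀ t ∈ Set.Icc a b, ‖u t * e t‖ ≤ 1 / μ := fun t ht => by
    rw [norm_mul, hen, mul_one, hu]
    simp only [norm_mul, norm_neg, Complex.norm_I, one_mul, Complex.norm_real, norm_inv,
      Real.norm_eq_abs]
    rw [one_div]
    exact inv_anti₀ hμ (h t ht)
  have hint : ‖∫ t in a..b, u' t * e t‖ ≤
      ∫ t in a..b, |f.derivative.derivative.eval t| / (f.derivative.eval t) ^ 2 := by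
    refine (intervalIntegral.norm_integral_le_integral_norm hab).trans (le_of_eq ?_)
    refine intervalIntegral.integral_congr fun t _ => ?_
    simp [hu', hen]
  rw [hosc, hparts]
  calc _ ≤ ‖u b * e b‖ + ‖u a * e a‖ + ‖∫ t in a..b, u' t * e t‖ :=
        (norm_sub_le _ _).trans (by gcongr; exact norm_sub_le _ _)
    _ ≤ 1 / μ + 1 / μ + _ :=
        add_le_add (add_le_add (hun b ⟨hab, le_rfl⟩) (hun a ⟨le_rfl, hab⟩)) hint
    _ = _ := by ring

/-- A polynomial bounded away from zero on an interval has constant sign there. -/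
theorem Polynomial.le_eval_or_eval_le_neg (g : Polynomial ℝ) {a b μ : ℝ}
    (hμ : 0 < μ) (h : ∀ t ∈ Set.Icc a b, μ ≤ |g.eval t|) :
    (∀ t ∈ Set.Icc a b, μ ≤ g.eval t) ∨ ∀ t ∈ Set.Icc a b, g.eval t ≤ -μ := by
  by_contra! hcon
  obtain ⟨⟨s, hs, hs'⟩, t, ht, ht'⟩ := hcon
  have hs1 : g.eval s ≤ -μ := by
    rcases le_abs.1 (h s hs) with h1 | h1 <;> linarith
  have ht1 : μ ≤ g.eval t := by
    rcases le_abs.1 (h t ht) with h1 | h1 <;> linarith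
  obtain ⟨c, hc, hc0⟩ := isPreconnected_Icc.intermediate_value hs ht g.continuous.continuousOn
    (show (0 : ℝ) ∈ Set.Icc (g.eval s) (g.eval t) from ⟨by linarith, by linarith⟩)
  have := h c hc
  simp only [hc0, abs_zero] at this
  linarith

/-- The first derivative test when the derivative of the phase is monotone. -/
theorem norm_oscillatoryIntegral_le_of_le_abs_derivative (f : Polynomial ℝ) {a b μ : ℝ}
    (hab : a ≤ b) (hμ : 0 < μ) (h : ∀ t ∈ Set.Icc a b, μ ≤ |f.derivative.eval t|)
    (hsign : (∀ t ∈ Set.Icc a b, 0 ≤ f.derivative.derivative.eval t) ∨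
      ∀ t ∈ Set.Icc a b, f.derivative.derivative.eval t ≤ 0) :
    ‖oscillatoryIntegral f a b‖ ≤ 4 / μ := by
  have hne : ∀ t ∈ Set.Icc a b, f.derivative.eval t ≠ 0 := fun t ht h0 => by
    have := h t ht
    rw [h0, abs_zero] at this
    linarith
  have hI : Set.uIcc a b = Set.Icc a b := Set.uIcc_of_le hab
  have hquot : ContinuousOn
      (fun t => -(f.derivative.derivative.eval t) / (f.derivative.eval t) ^ 2) (Set.Icc a b) :=
    (f.derivative.derivative.continuous.neg.continuousOn).div
      (f.derivative.continuous.pow 2).continuousOn fun t ht => pow_ne_zero 2 (hne t ht)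
  have hftc : ∫ t in a..b, -(f.derivative.derivative.eval t) / (f.derivative.eval t) ^ 2 =
      (f.derivative.eval b)⁻¹ - (f.derivative.eval a)⁻¹ :=
    intervalIntegral.integral_eq_sub_of_hasDerivAt
      (f := fun t => (f.derivative.eval t)⁻¹)
      (fun t ht => (f.derivative.hasDerivAt t).inv (hne t (hI ▸ ht)))
      (by rw [← hI] at hquot; exact hquot.intervalIntegrable)
  have hinv : ∀ t ∈ Set.Icc a b, |(f.derivative.eval t)⁻¹| ≤ 1 / μ := fun t ht => by
    rw [abs_inv, one_div]
    exact inv_anti₀ hμ (h t ht)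
  have hb := abs_le.1 (hinv b ⟨hab, le_rfl⟩)
  have ha := abs_le.1 (hinv a ⟨le_rfl, hab⟩)
  have key : ∫ t in a..b, |f.derivative.derivative.eval t| / (f.derivative.eval t) ^ 2 ≤
      2 * (1 / μ) := by
    rcases hsign with hs | hs
    · have : ∫ t in a..b, |f.derivative.derivative.eval t| / (f.derivative.eval t) ^ 2 =
          -∫ t in a..b, -(f.derivative.derivative.eval t) / (f.derivative.eval t) ^ 2 := by
        rw [← intervalIntegral.integral_neg]
        refine intervalIntegral.integral_congr fun t ht => ?_
        simp only [abs_of_nonneg (hs t (hI ▸ ht))]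
        ring
      rw [this, hftc]
      linarith [hb.1, hb.2, ha.1, ha.2]
    · have : ∫ t in a..b, |f.derivative.derivative.eval t| / (f.derivative.eval t) ^ 2 =
          ∫ t in a..b, -(f.derivative.derivative.eval t) / (f.derivative.eval t) ^ 2 := by
        refine intervalIntegral.integral_congr fun t ht => ?_
        simp only [abs_of_nonpos (hs t (hI ▸ ht))]
      rw [this, hftc]
      linarith [hb.1, hb.2, ha.1, ha.2]
  calc _ ≤ 2 / μ + 2 * (1 / μ) :=
        (norm_oscillatoryIntegral_le_add_integral f hab hμ h).trans (by gcongr)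
    _ = 4 / μ := by ring

/-- A polynomial whose derivative is bounded below by `μ > 0` in absolute value grows at least
linearly away from some point of the interval. -/
theorem Polynomial.exists_mul_abs_sub_le_abs_eval (g : Polynomial ℝ) {a b μ : ℝ} (hab : a ≤ b)
    (hμ : 0 < μ) (h : ∀ t ∈ Set.Icc a b, μ ≤ |g.derivative.eval t|) :
    ∃ c ∈ Set.Icc a b, ∀ t ∈ Set.Icc a b, μ * |t - c| ≤ |g.eval t| := by
  wlog hpos : ∀ t ∈ Set.Icc a b, μ ≤ g.derivative.eval t generalizing g
  · obtain ⟨c, hc, hc'⟩ := this (-g) (by simpa using h) (by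
      intro t ht
      have := (g.derivative.le_eval_or_eval_le_neg hμ h).resolve_left hpos t ht
      simp only [Polynomial.derivative_neg, Polynomial.eval_neg]
      linarith)
    exact ⟨c, hc, by simpa using hc'⟩
  have hmono : ∀ s ∈ Set.Icc a b, ∀ t ∈ Set.Icc a b, s ≤ t →
      μ * (t - s) ≤ g.eval t - g.eval s :=
    (convex_Icc a b).mul_sub_le_image_sub_of_le_deriv g.continuous.continuousOn
      g.differentiable.differentiableOn fun t ht => by
        rw [Polynomial.deriv]
        exact hpos t (interior_subset ht)
  have hz : ∀ c ∈ Set.Icc a b, (g.eval c = 0 ∨ c = a ∧ 0 ≤ g.eval c ∨ c = b ∧ g.eval c ≤ 0) →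
      ∀ t ∈ Set.Icc a b, μ * |t - c| ≤ |g.eval t| := by
    intro c hc hcase t ht
    rcases le_total c t with hct | hct
    · rw [abs_of_nonneg (sub_nonneg.2 hct)]
      have h1 := hmono c hc t ht hct
      rcases hcase with h0 | ⟨h0, h2⟩ | ⟨h0, h2⟩
      · exact le_trans (by linarith) (le_abs_self _)
      · exact le_trans (by linarith) (le_abs_self _)
      · have : t = c := le_antisymm (h0 ▸ ht.2) hct
        simp [this]
    · rw [abs_of_nonpos (sub_nonpos.2 hct)]
      have h1 := hmono t ht c hc hct
      rcases hcase with h0 | ⟨h0, h2⟩ | ⟨h0, h2⟩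
      · exact le_trans (by linarith) (neg_le_abs _)
      · have : t = c := le_antisymm hct (h0 ▸ ht.1)
        simp [this]
      · exact le_trans (by linarith) (neg_le_abs _)
  rcases le_total 0 (g.eval a) with ha | ha
  · exact ⟨a, ⟨le_rfl, hab⟩, hz a ⟨le_rfl, hab⟩ (Or.inr (Or.inl ⟨rfl, ha⟩))⟩
  rcases le_total (g.eval b) 0 with hb | hb
  · exact ⟨b, ⟨hab, le_rfl⟩, hz b ⟨hab, le_rfl⟩ (Or.inr (Or.inr ⟨rfl, hb⟩))⟩
  obtain ⟨c, hc, hc0⟩ := intermediate_value_Icc hab g.continuous.continuousOn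
    (show (0 : ℝ) ∈ Set.Icc (g.eval a) (g.eval b) from ⟨ha, hb⟩)
  exact ⟨c, hc, hz c hc (Or.inl hc0)⟩

/-- If `|g'| ≥ μ`, then an oscillatory integral splits into a short interval where `g` may be small
and at most two intervals where `|g| ≥ μ δ`. -/
theorem norm_oscillatoryIntegral_le_of_le_off_small (f g : Polynomial ℝ) {a b μ δ B : ℝ}
    (hab : a ≤ b) (hμ : 0 < μ) (hδ : 0 < δ) (hB : 0 ≤ B)
    (h : ∀ t ∈ Set.Icc a b, μ ≤ |g.derivative.eval t|)
    (hsub : ∀ u v, a ≤ u → u ≤ v → v ≤ b → (∀ t ∈ Set.Icc u v, μ * δ ≤ |g.eval t|) →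
      ‖oscillatoryIntegral f u v‖ ≤ B) :
    ‖oscillatoryIntegral f a b‖ ≤ 2 * B + 2 * δ := by
  obtain ⟨c, hc, hgc⟩ := g.exists_mul_abs_sub_le_abs_eval hab hμ h
  have hself : ∀ u, oscillatoryIntegral f u u = 0 := fun u => intervalIntegral.integral_same
  have hleft : ‖oscillatoryIntegral f a (max a (c - δ))‖ ≤ B := by
    rcases le_total (c - δ) a with h1 | h1
    · rwa [max_eq_left h1, hself, norm_zero]
    · rw [max_eq_right h1]
      refine hsub _ _ le_rfl h1 (by linarith [hc.2]) fun t ht => le_trans ?_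
        (hgc t ⟨ht.1, by linarith [ht.2, hc.2]⟩)
      gcongr
      exact le_trans (by linarith [ht.2]) (neg_le_abs _)
  have hright : ‖oscillatoryIntegral f (min b (c + δ)) b‖ ≤ B := by
    rcases le_total b (c + δ) with h1 | h1
    · rwa [min_eq_left h1, hself, norm_zero]
    · rw [min_eq_right h1]
      refine hsub _ _ (by linarith [hc.1]) h1 le_rfl fun t ht => le_trans ?_
        (hgc t ⟨by linarith [ht.1, hc.1], ht.2⟩)
      gcongr
      exact le_trans (by linarith [ht.1]) (le_abs_self _)
  have hmid : ‖oscillatoryIntegral f (max a (c - δ)) (min b (c + δ))‖ ≤ 2 * δ := by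
    have h1 : max a (c - δ) ≤ c := max_le hc.1 (by linarith)
    have h2 : c ≤ min b (c + δ) := le_min hc.2 (by linarith)
    refine (norm_oscillatoryIntegral_le_sub f (h1.trans h2)).trans ?_
    linarith [le_max_right a (c - δ), min_le_right b (c + δ)]
  rw [← oscillatoryIntegral_add_adjacent f a (max a (c - δ)) b,
    ← oscillatoryIntegral_add_adjacent f (max a (c - δ)) (min b (c + δ)) b]
  refine (norm_add_le _ _).trans ?_
  linarith [norm_add_le (oscillatoryIntegral f (max a (c - δ)) (min b (c + δ)))
    (oscillatoryIntegral f (min b (c + δ)) b)]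

/-- Van der Corput's lemma for derivatives of order at least two. -/
theorem exists_norm_oscillatoryIntegral_le_rpow (k : ℕ) :
    ∃ C : ℝ, 0 ≤ C ∧ ∀ (f : Polynomial ℝ) (a b μ : ℝ), a ≤ b → 0 < μ →
      (∀ t ∈ Set.Icc a b, μ ≤ |(Polynomial.derivative^[k + 2] f).eval t|) →
      ‖oscillatoryIntegral f a b‖ ≤ C * μ ^ (-(1 / ((k + 2 : ℕ) : ℝ))) := by
  induction k with
  | zero =>
    refine ⟨10, by norm_num, fun f a b μ hab hμ h => ?_⟩
    simp only [zero_add, Function.iterate_succ, Function.iterate_zero, Function.comp_apply,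
      id] at h
    have hsign := f.derivative.derivative.le_eval_or_eval_le_neg hμ h
    set δ : ℝ := μ ^ (-(1 / ((0 + 2 : ℕ) : ℝ))) with hδ
    have hδ0 : 0 < δ := rpow_pos_of_pos hμ _
    have hμδ : 4 / (μ * δ) = 4 * δ := by
      have h1 : μ * δ * δ = 1 := by
        rw [hδ, mul_assoc, ← rpow_add hμ]
        norm_num
        rw [rpow_neg_one, mul_inv_cancel₀ hμ.ne']
      have : 0 < μ * δ := by positivity
      field_simp
      linarith
    have := norm_oscillatoryIntegral_le_of_le_off_small f f.derivative (B := 4 * δ) hab hμ hδ0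
      (by positivity) h fun u v hu huv hv huv' => by
        rw [← hμδ]
        refine norm_oscillatoryIntegral_le_of_le_abs_derivative f huv (by positivity) huv' ?_
        rcases hsign with hs | hs
        · exact Or.inl fun t ht => hμ.le.trans (hs t ⟨hu.trans ht.1, ht.2.trans hv⟩)
        · exact Or.inr fun t ht => (hs t ⟨hu.trans ht.1, ht.2.trans hv⟩).trans (by linarith)
    linarith
  | succ k ih =>
    obtain ⟨C, hC, ih⟩ := ih
    refine ⟨2 * C + 2, by positivity, fun f a b μ hab hμ h => ?_⟩
    set δ : ℝ := μ ^ (-(1 / ((k + 1 + 2 : ℕ) : ℝ))) with hδ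
    have hδ0 : 0 < δ := rpow_pos_of_pos hμ _
    have hμδ : (μ * δ) ^ (-(1 / ((k + 2 : ℕ) : ℝ))) = δ := by
      have : μ * δ = μ ^ (1 + -(1 / ((k + 1 + 2 : ℕ) : ℝ))) := by
        rw [rpow_add hμ, rpow_one]
      rw [this, ← rpow_mul hμ.le, hδ]
      congr 1
      push_cast
      have : (k : ℝ) + 2 ≠ 0 := by positivity
      have : (k : ℝ) + 1 + 2 ≠ 0 := by positivity
      field_simp
      ring
    have := norm_oscillatoryIntegral_le_of_le_off_small f (Polynomial.derivative^[k + 2] f)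
      (B := C * δ) hab hμ hδ0 (by positivity)
      (fun t ht => by
        rw [← Function.iterate_succ_apply' Polynomial.derivative (k + 2) f]
        exact h t ht)
      fun u v hu huv hv huv' => by
        rw [← hμδ]
        exact ih f u v (μ * δ) huv (by positivity) huv'
    linarith

/-- Van der Corput's lemma for derivatives of every positive order; the upper bound on the second
derivative of the phase replaces monotonicity of the first derivative when `k = 1`. -/
theorem exists_norm_oscillatoryIntegral_le_of_scaled {k : ℕ} (hk : 0 < k) {m K : ℝ} (hm : 0 < m)
    (hK : 0 ≤ K) :
    ∃ C : ℝ, 0 ≤ C ∧ ∀ (f : Polynomial ℝ) (a b T : ℝ), a ≤ b → b - a ≤ 1 → 0 < T →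
      (∀ t ∈ Set.Icc a b, T * m ≤ |(Polynomial.derivative^[k] f).eval t|) →
      (∀ t ∈ Set.Icc a b, |(Polynomial.derivative^[2] f).eval t| ≤ T * K) →
      ‖oscillatoryIntegral f a b‖ ≤ C * T ^ (-(1 / (k : ℝ))) := by
  obtain rfl | ⟨j, rfl⟩ : k = 1 ∨ ∃ j, k = j + 2 := by
    rcases k with _ | _ | j
    · omega
    · exact Or.inl rfl
    · exact Or.inr ⟨j, rfl⟩
  · refine ⟨2 / m + K / m ^ 2, by positivity, fun f a b T hab hab1 hT h h2 => ?_⟩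
    simp only [Function.iterate_succ, Function.iterate_zero, Function.comp_apply, id] at h h2
    have hTm : 0 < T * m := by positivity
    refine (norm_oscillatoryIntegral_le_add_integral f hab hTm h).trans ?_
    have hbound : ∀ t ∈ Set.uIoc a b,
        ‖|f.derivative.derivative.eval t| / (f.derivative.eval t) ^ 2‖ ≤
          T * K / (T * m) ^ 2 := by
      intro t ht
      rw [Set.uIoc_of_le hab] at ht
      have ht' := Set.Ioc_subset_Icc_self ht
      rw [Real.norm_of_nonneg (by positivity), ← sq_abs (f.derivative.eval t)]
      have := h t ht'
      have := h2 t ht'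
      gcongr
    have hint := (le_abs_self _).trans
      (intervalIntegral.norm_integral_le_of_norm_le_const hbound)
    rw [abs_of_nonneg (sub_nonneg.2 hab)] at hint
    calc _ ≤ 2 / (T * m) + T * K / (T * m) ^ 2 * 1 := by
          gcongr
          exact hint.trans (by gcongr)
      _ = _ := by
          rw [Nat.cast_one, div_one, rpow_neg_one]
          field_simp
  · obtain ⟨C, hC, hvdc⟩ := exists_norm_oscillatoryIntegral_le_rpow j
    refine ⟨C * m ^ (-(1 / ((j + 2 : ℕ) : ℝ))), by positivity,
      fun f a b T hab _ hT h _ => ?_⟩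
    refine (hvdc f a b (T * m) hab (by positivity) h).trans (le_of_eq ?_)
    rw [mul_rpow hT.le hm.le]
    ring

/-- A nonzero polynomial has a nonvanishing derivative, of order at most its degree, at any point. -/
theorem Polynomial.exists_iterate_derivative_eval_ne_zero {p : Polynomial ℝ} (hp : p ≠ 0) (t : ℝ) :
    ∃ k ≤ p.natDegree, (Polynomial.derivative^[k] p).eval t ≠ 0 := by
  by_contra! hcon
  have h1 := (Polynomial.lt_rootMultiplicity_iff_isRoot_iterate_derivative (t := t) hp).2 hcon
  have h2 : p.rootMultiplicity t ≤ p.natDegree := by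
    classical
    rw [← Polynomial.count_roots]
    exact (Multiset.count_le_card _ _).trans p.card_roots'
  omega

theorem Polynomial.continuous_eval_iterate_derivative_sum {ι : Type*} [Fintype ι]
    (P : ι → Polynomial ℝ) (k : ℕ) :
    Continuous fun z : (ι → ℝ) × ℝ =>
      (Polynomial.derivative^[k] (∑ i, Polynomial.C (z.1 i) * P i)).eval z.2 := by
  simp only [Polynomial.iterate_derivative_sum, Polynomial.iterate_derivative_C_mul,
    Polynomial.eval_finsetSum, Polynomial.eval_mul, Polynomial.eval_C]
  refine continuous_finsetSum _ fun i _ => ?_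
  have := (Polynomial.derivative^[k] (P i)).continuous
  fun_prop

/-- Uniform decay of oscillatory integrals over the unit sphere of a finite-dimensional family of
polynomial phases that are linearly independent modulo constants. -/
theorem exists_norm_oscillatoryIntegral_family_le {ι : Type*} [Fintype ι] (P : ι → Polynomial ℝ)
    {d : ℕ} (hdeg : ∀ i, (P i).natDegree ≤ d)
    (hP : ∀ x : ι → ℝ, x ≠ 0 → (∑ i, Polynomial.C (x i) * P i).derivative ≠ 0) :
    ∃ C : ℝ, 0 ≤ C ∧ ∀ x : ι → ℝ, ‖x‖ = 1 → ∀ T : ℝ, 0 < T →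
      ‖oscillatoryIntegral (Polynomial.C T * ∑ i, Polynomial.C (x i) * P i) 0 1‖ ≤
        C * T ^ (-(1 / (d : ℝ))) := by
  set Q : (ι → ℝ) → Polynomial ℝ := fun x => ∑ i, Polynomial.C (x i) * P i with hQ
  set S : Set ((ι → ℝ) × ℝ) := Metric.sphere 0 1 ×ˢ Set.Icc 0 1 with hS
  have hScomp : IsCompact S := (isCompact_sphere _ _).prod isCompact_Icc
  have hQcont : ∀ k, Continuous fun z : (ι → ℝ) × ℝ =>
      (Polynomial.derivative^[k] (Q z.1)).eval z.2 :=
    Polynomial.continuous_eval_iterate_derivative_sum P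
  have hQdeg : ∀ x, (Q x).natDegree ≤ d := fun x =>
    Polynomial.natDegree_sum_le_of_forall_le _ _ fun i _ =>
      (Polynomial.natDegree_C_mul_le _ _).trans (hdeg i)
  have hsumcont : ∀ N, Continuous fun z : (ι → ℝ) × ℝ =>
      ∑ k ∈ range N, |(Polynomial.derivative^[k + 1] (Q z.1)).eval z.2| := fun N =>
    continuous_finsetSum _ fun k _ => (hQcont (k + 1)).abs
  obtain ⟨c, hc, hlow⟩ := hScomp.exists_forall_le' (a := 0) (hsumcont d).continuousOn (by
    rintro ⟨x, t⟩ ⟨hx, -⟩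
    have hx0 : x ≠ 0 := by
      rintro rfl
      simp at hx
    obtain ⟨k, hk, hkt⟩ := Polynomial.exists_iterate_derivative_eval_ne_zero (hP x hx0) t
    have hkd : k < d := by
      have hpos : (Q x).natDegree ≠ 0 := fun h0 => hP x hx0 (by
        rw [Polynomial.eq_C_of_natDegree_eq_zero (p := ∑ i, Polynomial.C (x i) * P i) h0,
          Polynomial.derivative_C])
      have h1 : (Q x).derivative.natDegree < (Q x).natDegree :=
        Polynomial.natDegree_derivative_lt hpos
      exact (hk.trans_lt h1).trans_le (hQdeg x)
    exact Finset.sum_pos' (fun _ _ => abs_nonneg _) ⟨k, mem_range.2 hkd, abs_pos.2 hkt⟩)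
  obtain ⟨K, hK⟩ := hScomp.exists_bound_of_continuousOn (hsumcont (d + 2)).continuousOn
  replace hK : ∀ k < d + 2, ∀ x : ι → ℝ, ‖x‖ = 1 → ∀ t ∈ Set.Icc (0 : ℝ) 1,
      |(Polynomial.derivative^[k + 1] (Q x)).eval t| ≤ max K 0 := fun k hk x hx t ht =>
    ((Finset.single_le_sum
      (f := fun k => |(Polynomial.derivative^[k + 1] (Q x)).eval t|)
      (fun _ _ => abs_nonneg _) (mem_range.2 hk)).trans
        ((le_abs_self _).trans (hK (x, t) ⟨by simpa using hx, ht⟩))).trans (le_max_left _ _)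
  set K' := max K 0 with hK'
  have hK'0 : 0 ≤ K' := le_max_right _ _
  set m : ℝ := c / (d + 1) / 2 with hm
  have hm0 : 0 < m := by positivity
  have hpigeon : ∀ x : ι → ℝ, ‖x‖ = 1 → ∀ t ∈ Set.Icc (0 : ℝ) 1, ∃ k < d,
      2 * m ≤ |(Polynomial.derivative^[k + 1] (Q x)).eval t| := by
    intro x hx t ht
    by_contra! hcon
    have h1 := hlow (x, t) ⟨by simpa using hx, ht⟩
    have h2 := Finset.sum_le_card_nsmul (range d)
      (fun k => |(Polynomial.derivative^[k + 1] (Q x)).eval t|) (2 * m)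
      fun k hk => (hcon k (mem_range.1 hk)).le
    have h3 : (d : ℝ) * (2 * m) < c := by
      rw [hm]
      field_simp
      linarith
    rw [card_range, nsmul_eq_mul] at h2
    exact absurd (h1.trans h2) (not_le.2 h3)
  choose! Cv hCv0 hCv using fun (k : ℕ) (hk : 0 < k) =>
    exists_norm_oscillatoryIntegral_le_of_scaled hk hm0 hK'0
  obtain ⟨N, hN⟩ := exists_nat_gt (K' / m)
  have hN0 : (0 : ℝ) < N := (by positivity : 0 ≤ K' / m).trans_lt hN
  have hKN : K' * (1 / N) ≤ m := by
    rw [div_lt_iff₀ hm0] at hN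
    rw [mul_one_div, div_le_iff₀ hN0]
    linarith
  have hCsum : 0 ≤ ∑ k ∈ range d, Cv (k + 1) :=
    Finset.sum_nonneg fun k _ => hCv0 (k + 1) k.succ_pos
  refine ⟨N * ∑ k ∈ range d, Cv (k + 1) + 1, by positivity, fun x hx T hT => ?_⟩
  rcases lt_or_ge T 1 with hT1 | hT1
  · calc _ ≤ (1 : ℝ) - 0 := norm_oscillatoryIntegral_le_sub _ zero_le_one
      _ ≤ T ^ (-(1 / (d : ℝ))) := by
          rw [sub_zero]
          exact one_le_rpow_of_pos_of_le_one_of_nonpos hT hT1.le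
            (neg_nonpos.2 (by positivity))
      _ ≤ _ := le_mul_of_one_le_left (by positivity) (by
          have : 0 ≤ N * ∑ k ∈ range d, Cv (k + 1) := by positivity
          linarith)
  have hpiece : ∀ i < N, ‖oscillatoryIntegral (Polynomial.C T * Q x) ((i : ℝ) / N)
      (((i + 1 : ℕ) : ℝ) / N)‖ ≤ (∑ k ∈ range d, Cv (k + 1)) * T ^ (-(1 / (d : ℝ))) := by
    intro i hi
    set u : ℝ := (i : ℝ) / N with hu
    have huv : ((i + 1 : ℕ) : ℝ) / N = u + 1 / N := by
      rw [hu]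
      push_cast
      ring
    have hv1 : u + 1 / N ≤ 1 := by
      rw [← huv, div_le_one hN0]
      exact_mod_cast hi
    have hu0 : 0 ≤ u := by positivity
    have hN1 : 0 < 1 / (N : ℝ) := by positivity
    have hsub : ∀ t ∈ Set.Icc u (u + 1 / N), t ∈ Set.Icc (0 : ℝ) 1 := fun t ht =>
      ⟨hu0.trans ht.1, ht.2.trans hv1⟩
    obtain ⟨k, hk, hku⟩ := hpigeon x hx u (hsub u ⟨le_rfl, by linarith⟩)
    have hlip : ∀ t ∈ Set.Icc u (u + 1 / N),
        m ≤ |(Polynomial.derivative^[k + 1] (Q x)).eval t| := by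
      intro t ht
      have h1 := (convex_Icc (0 : ℝ) 1).norm_image_sub_le_of_norm_hasDerivWithin_le
        (f := fun s => (Polynomial.derivative^[k + 1] (Q x)).eval s)
        (fun s _ => (Polynomial.hasDerivAt _ s).hasDerivWithinAt)
        (fun s hs => by
          rw [← Function.iterate_succ_apply' Polynomial.derivative (k + 1) (Q x)]
          exact hK (k + 1) (by omega) x hx s hs)
        (hsub u ⟨le_rfl, by linarith⟩) (hsub t ht)
      simp only [Real.norm_eq_abs] at h1
      have h2 : K' * |t - u| ≤ m := by
        refine le_trans ?_ hKN
        gcongr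
        rw [abs_of_nonneg (by linarith [ht.1])]
        linarith [ht.2]
      have h3 := abs_sub_abs_le_abs_sub ((Polynomial.derivative^[k + 1] (Q x)).eval u)
        ((Polynomial.derivative^[k + 1] (Q x)).eval t)
      rw [abs_sub_comm] at h3
      linarith
    have hvdc := hCv (k + 1) k.succ_pos (Polynomial.C T * Q x) u (u + 1 / N) T (by linarith)
      (by linarith) hT
      (fun t ht => by
        rw [Polynomial.iterate_derivative_C_mul, Polynomial.eval_mul, Polynomial.eval_C, abs_mul,
          abs_of_pos hT]
        have := hlip t ht
        gcongr)
      (fun t ht => by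
        rw [Polynomial.iterate_derivative_C_mul, Polynomial.eval_mul, Polynomial.eval_C, abs_mul,
          abs_of_pos hT]
        have := hK 1 (by omega) x hx t (hsub t ht)
        gcongr)
    rw [huv]
    refine hvdc.trans ?_
    have hCk : Cv (k + 1) ≤ ∑ k ∈ range d, Cv (k + 1) :=
      Finset.single_le_sum (f := fun k => Cv (k + 1)) (fun k _ => hCv0 (k + 1) k.succ_pos)
        (mem_range.2 hk)
    have hexp : T ^ (-(1 / ((k + 1 : ℕ) : ℝ))) ≤ T ^ (-(1 / (d : ℝ))) := by
      refine rpow_le_rpow_of_exponent_le hT1 (neg_le_neg ?_)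
      refine one_div_le_one_div_of_le (by positivity) ?_
      exact_mod_cast hk
    gcongr
  have hsum : oscillatoryIntegral (Polynomial.C T * Q x) 0 1 =
      ∑ i ∈ range N, oscillatoryIntegral (Polynomial.C T * Q x) ((i : ℝ) / N)
        (((i + 1 : ℕ) : ℝ) / N) := by
    have := intervalIntegral.sum_integral_adjacent_intervals (μ := volume) (n := N)
      (a := fun i : ℕ => (i : ℝ) / N) fun i _ =>
        (continuous_exp_I_mul_eval (Polynomial.C T * Q x)).intervalIntegrable _ _
    rw [Nat.cast_zero, zero_div, div_self hN0.ne'] at this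
    exact this.symm
  rw [hsum]
  calc _ ≤ ∑ i ∈ range N, (∑ k ∈ range d, Cv (k + 1)) * T ^ (-(1 / (d : ℝ))) :=
        (norm_sum_le _ _).trans (Finset.sum_le_sum fun i hi => hpiece i (mem_range.1 hi))
    _ = N * (∑ k ∈ range d, Cv (k + 1)) * T ^ (-(1 / (d : ℝ))) := by
        rw [sum_const, card_range, nsmul_eq_mul, mul_assoc]
    _ ≤ _ := by
        gcongr
        linarith

/-- The components of a polynomial curve with coefficient matrix `A` and no constant term. -/
noncomputable def Matrix.rowPolynomial {n d : ℕ} (A : Matrix (Fin n) (Fin d) ℝ) (j : Fin n) :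
    Polynomial ℝ :=
  ∑ k : Fin d, Polynomial.C (A j k) * Polynomial.X ^ ((k : ℕ) + 1)

theorem Matrix.natDegree_rowPolynomial_le {n d : ℕ} (A : Matrix (Fin n) (Fin d) ℝ) (j : Fin n) :
    (A.rowPolynomial j).natDegree ≤ d :=
  Polynomial.natDegree_sum_le_of_forall_le _ _ fun k _ =>
    (Polynomial.natDegree_C_mul_X_pow_le _ _).trans k.isLt

theorem Matrix.coeff_rowPolynomial {n d : ℕ} (A : Matrix (Fin n) (Fin d) ℝ) (j : Fin n)
    (k : Fin d) : (A.rowPolynomial j).coeff ((k : ℕ) + 1) = A j k := by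
  rw [Matrix.rowPolynomial, Polynomial.finsetSum_coeff, Finset.sum_eq_single k]
  · simp
  · intro l _ hl
    rw [Polynomial.coeff_C_mul_X_pow, if_neg]
    intro h
    exact hl (Fin.ext (by omega))
  · simp

theorem Matrix.derivative_sum_rowPolynomial_ne_zero {n d : ℕ} (A : Matrix (Fin n) (Fin d) ℝ)
    {x : Fin n → ℝ} (hx : Aᵀ.mulVec x ≠ 0) :
    (∑ j, Polynomial.C (x j) * A.rowPolynomial j).derivative ≠ 0 := by
  intro h
  refine hx (funext fun k => ?_)
  have hk := congrArg (fun p : Polynomial ℝ => p.coeff k) h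
  simp only [Polynomial.coeff_derivative, Polynomial.finsetSum_coeff, Polynomial.coeff_C_mul,
    Matrix.coeff_rowPolynomial, Polynomial.coeff_zero, mul_eq_zero] at hk
  have hk' := hk.resolve_right (by positivity)
  simpa [Matrix.mulVec, dotProduct, mul_comm] using hk'

/-- Let `p : ℝ → ℝ^n` be the polynomial curve `p_j(t) = ∑_{k=1}^d a_{jk} t^k` with `d ≥ n` and
coefficient matrix `A = (a_{jk})`. If the kernel of the transpose `A*` is trivial over `ℝ`, then
there is a constant `C > 0` such that for all `λ > 0`,
`sup_{ν ∈ ℤ^n \ {0}} ‖ν‖^{1/d} |μ̂_λ(ν)| ≤ C / λ^{1/d}`, where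
`μ̂_λ(ν) = ∫₀¹ e^{2πiλ⟨ν, p(t)⟩} dt` and `‖·‖` is the `ℓ¹`-norm. -/
theorem fourier_decay_real_kernel (n d : ℕ) (hnd : n ≤ d) (hd : 0 < d)
    (A : Matrix (Fin n) (Fin d) ℝ)
    (hker : ∀ x : Fin n → ℝ, x ≠ 0 → Aᵀ.mulVec x ≠ 0) :
    ∃ C > 0, ∀ lam : ℝ, 0 < lam → ∀ ν : Fin n → ℤ, ν ≠ 0 →
      (∑ j, |(ν j : ℝ)|) ^ ((1:ℝ)/d) *
          ‖∫ t in (0:ℝ)..1, Complex.exp (2 * π * Complex.I *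
            ((lam * ∑ j, (ν j : ℝ) * ∑ k : Fin d, A j k * t ^ ((k : ℕ) + 1) : ℝ) : ℂ))‖
        ≤ C / lam ^ ((1:ℝ)/d) := by
  obtain ⟨C, hC, hmain⟩ := exists_norm_oscillatoryIntegral_family_le A.rowPolynomial
    A.natDegree_rowPolynomial_le fun x hx => A.derivative_sum_rowPolynomial_ne_zero (hker x hx)
  refine ⟨C * (n / (2 * π)) ^ ((1 : ℝ) / d) + 1, by positivity, fun lam hlam ν hν => ?_⟩
  set y : Fin n → ℝ := fun j => (ν j : ℝ) with hy
  have hy0 : y ≠ 0 := fun h => hν (funext fun j => by simpa [hy] using congrFun h j)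
  set r : ℝ := ‖y‖ with hr
  have hr0 : 0 < r := norm_pos_iff.2 hy0
  have hint : ∫ t in (0:ℝ)..1, Complex.exp (2 * π * Complex.I *
      ((lam * ∑ j, (ν j : ℝ) * ∑ k : Fin d, A j k * t ^ ((k : ℕ) + 1) : ℝ) : ℂ)) =
      oscillatoryIntegral (Polynomial.C (2 * π * lam * r) *
        ∑ j, Polynomial.C ((r⁻¹ • y) j) * A.rowPolynomial j) 0 1 := by
    refine intervalIntegral.integral_congr fun t _ => ?_
    have : (Polynomial.C (2 * π * lam * r) *
        ∑ j, Polynomial.C ((r⁻¹ • y) j) * A.rowPolynomial j).eval t =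
        2 * π * (lam * ∑ j, (ν j : ℝ) * ∑ k : Fin d, A j k * t ^ ((k : ℕ) + 1)) := by
      simp only [Matrix.rowPolynomial, Polynomial.eval_mul, Polynomial.eval_C,
        Polynomial.eval_finsetSum, Polynomial.eval_pow, Polynomial.eval_X, Pi.smul_apply,
        smul_eq_mul, mul_assoc, ← Finset.mul_sum, hy]
      rw [mul_inv_cancel_left₀ hr0.ne']
    simp only [this]
    congr 1
    push_cast
    ring
  have hnorm : ‖r⁻¹ • y‖ = 1 := by
    rw [norm_smul, norm_inv, norm_norm, inv_mul_cancel₀ hr0.ne']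
  have hl1 : ∑ j, |(ν j : ℝ)| ≤ n * r := by
    refine (Finset.sum_le_card_nsmul _ _ r fun j _ => norm_le_pi_norm y j).trans (le_of_eq ?_)
    rw [card_univ, Fintype.card_fin, nsmul_eq_mul]
  rw [hint]
  calc _ ≤ (n * r) ^ ((1 : ℝ) / d) * (C * (2 * π * lam * r) ^ (-((1 : ℝ) / d))) := by
        gcongr
        exact hmain _ hnorm _ (by positivity)
    _ = C * (n / (2 * π)) ^ ((1 : ℝ) / d) / lam ^ ((1 : ℝ) / d) := by
        rw [rpow_neg (by positivity), mul_rpow (by positivity) hr0.le,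
          mul_rpow (by positivity) hr0.le, mul_rpow (by positivity) hlam.le,
          div_rpow (by positivity) (by positivity)]
        have := rpow_pos_of_pos hr0 ((1 : ℝ) / d)
        field_simp
    _ ≤ _ := by
        gcongr
        linarith
end

section
/- Let p : ℝ → ℝ^n be a polynomial curve with p_j(t) = ∑_{k=1}^{d} a_{jk} t^k for j = 1,…,n, where d ≥ n, with n×d coefficient matrix A = (a_{jk}), and suppose A*x ≠ 0 for every x ∈ ℝ^n \ {0}. Then the measures μ_λ converge to the Haar measure on 𝕋^n as pseudo-measures: for every continuous function f : 𝕋^n → ℂ whose Fourier series is absolutely summable (∑_{ν ∈ ℤ^n} |f̂(ν)| < ∞), one has ∫_{𝕋^n} f dμ_λ → ∫_{𝕋^n} f dm as λ → ∞, where m is the Haar probability measure on 𝕋^n. -/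
open MeasureTheory Finset Real Matrix Filter

/-- Convergence of integrals against probability measures on a compact space only has to be
checked on a set of continuous functions with dense linear span. -/
lemma tendsto_integral_of_span_dense {X ι : Type*} [TopologicalSpace X] [CompactSpace X]
    [MeasurableSpace X] [OpensMeasurableSpace X] {l : Filter ι} {ν : ι → Measure X}
    [∀ i, IsProbabilityMeasure (ν i)] {μ : Measure X} [IsProbabilityMeasure μ]
    {s : Set C(X, ℂ)} (hs : (Submodule.span ℂ s).topologicalClosure = ⊤)
    (h : ∀ g ∈ s, Tendsto (fun i => ∫ x, g x ∂ν i) l (nhds (∫ x, g x ∂μ))) (f : C(X, ℂ)) :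
    Tendsto (fun i => ∫ x, f x ∂ν i) l (nhds (∫ x, f x ∂μ)) := by
  have hint : ∀ (g : C(X, ℂ)) (m : Measure X) [IsProbabilityMeasure m], Integrable g m :=
    fun g m _ => (BoundedContinuousFunction.mkOfCompact g).integrable m
  have hspan : ∀ g ∈ Submodule.span ℂ s,
      Tendsto (fun i => ∫ x, g x ∂ν i) l (nhds (∫ x, g x ∂μ)) := by
    intro g hg
    induction hg using Submodule.span_induction with
    | mem g hg => exact h g hg
    | zero => simpa using tendsto_const_nhds
    | add g₁ g₂ _ _ h₁ h₂ =>
      simpa [integral_add (hint g₁ _) (hint g₂ _)] using h₁.add h₂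
    | smul c g _ h₁ => simpa [integral_const_mul] using h₁.const_mul c
  have hdist : ∀ (g₁ g₂ : C(X, ℂ)) (m : Measure X) [IsProbabilityMeasure m],
      dist (∫ x, g₁ x ∂m) (∫ x, g₂ x ∂m) ≤ dist g₁ g₂ := by
    intro g₁ g₂ m _
    rw [dist_eq_norm, ← integral_sub (hint g₁ m) (hint g₂ m)]
    refine (norm_integral_le_of_norm_le_const (C := dist g₁ g₂) (ae_of_all _ fun x => ?_)).trans
      (by simp)
    rw [← dist_eq_norm]
    exact ContinuousMap.dist_apply_le_dist x
  rw [Metric.tendsto_nhds]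
  intro ε hε
  have hf : f ∈ closure (Submodule.span ℂ s : Set C(X, ℂ)) := by
    rw [← Submodule.topologicalClosure_coe, hs]
    trivial
  obtain ⟨g, hg, hfg⟩ := Metric.mem_closure_iff.mp hf (ε / 3) (by positivity)
  filter_upwards [Metric.tendsto_nhds.mp (hspan g hg) (ε / 3) (by positivity)] with i hi
  have h₁ := hdist f g (ν i)
  have h₂ := hdist g f μ
  rw [dist_comm g f] at h₂
  have := dist_triangle4 (∫ x, f x ∂ν i) (∫ x, g x ∂ν i) (∫ x, g x ∂μ) (∫ x, f x ∂μ)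
  linarith

/-- Integration by parts: against an amplitude of the form `g * φ'`, the oscillatory integral with
phase `φ` tends to zero. -/
lemma tendsto_integral_deriv_mul_exp {φ φ' g g' : ℝ → ℝ} (a b : ℝ)
    (hφ : ∀ t, HasDerivAt φ (φ' t) t) (hg : ∀ t, HasDerivAt g (g' t) t)
    (hφ' : Continuous φ') (hg' : Continuous g') :
    Tendsto (fun lam : ℝ =>
        ∫ t in a..b, ((g t * φ' t : ℝ) : ℂ) * Complex.exp ((lam * φ t : ℝ) * Complex.I))
      atTop (nhds 0) := by
  have hφc : Continuous φ := continuous_iff_continuousAt.mpr fun t => (hφ t).continuousAt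
  set K : ℝ := |g b| + |g a| + |∫ t in a..b, ‖g' t‖|
  have hbound : ∀ᶠ lam : ℝ in atTop,
      ‖∫ t in a..b, ((g t * φ' t : ℝ) : ℂ) * Complex.exp ((lam * φ t : ℝ) * Complex.I)‖
        ≤ K / lam := by
    filter_upwards [eventually_gt_atTop 0] with lam hlam
    have hE : ∀ t, HasDerivAt (fun t => Complex.exp ((lam * φ t : ℝ) * Complex.I))
        (Complex.exp ((lam * φ t : ℝ) * Complex.I) * ((lam * φ' t : ℝ) * Complex.I)) t := by
      intro t
      exact ((((hφ t).const_mul lam).ofReal_comp).mul_const Complex.I).cexp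
    have hparts := intervalIntegral.integral_mul_deriv_eq_deriv_mul (a := a) (b := b)
      (fun t _ => (hg t).ofReal_comp) (fun t _ => hE t)
      ((Complex.continuous_ofReal.comp hg').intervalIntegrable _ _)
      (Continuous.intervalIntegrable (by fun_prop) _ _)
    have hfactor : ∫ t in a..b, (g t : ℂ) *
          (Complex.exp ((lam * φ t : ℝ) * Complex.I) * ((lam * φ' t : ℝ) * Complex.I))
        = (lam * Complex.I) *
          ∫ t in a..b, ((g t * φ' t : ℝ) : ℂ) * Complex.exp ((lam * φ t : ℝ) * Complex.I) := by
      rw [← intervalIntegral.integral_const_mul]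
      congr 1
      ext t
      push_cast
      ring
    rw [hfactor] at hparts
    have hnorm := congrArg norm hparts
    rw [norm_mul, norm_mul, Complex.norm_I, mul_one, Complex.norm_real, Real.norm_eq_abs,
      abs_of_pos hlam] at hnorm
    rw [le_div_iff₀ hlam, mul_comm, hnorm]
    have hrem : ‖∫ t in a..b, (g' t : ℂ) * Complex.exp ((lam * φ t : ℝ) * Complex.I)‖
        ≤ |∫ t in a..b, ‖g' t‖| := by
      refine (intervalIntegral.norm_integral_le_abs_integral_norm).trans_eq ?_
      simp_rw [norm_mul, Complex.norm_exp_ofReal_mul_I, Complex.norm_real, mul_one]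
    refine (norm_sub_le _ _).trans (add_le_add ((norm_sub_le _ _).trans ?_) hrem)
    simp_rw [norm_mul, Complex.norm_exp_ofReal_mul_I, Complex.norm_real, mul_one,
      Real.norm_eq_abs]
    exact le_rfl
  exact squeeze_zero_norm' hbound (tendsto_const_nhds.div_atTop tendsto_id)

/-- The oscillatory integral with a nonconstant polynomial phase tends to zero. -/
lemma tendsto_integral_exp_polynomial (P : Polynomial ℝ) (hP : P.derivative ≠ 0) :
    Tendsto (fun lam : ℝ => ∫ t in (0 : ℝ)..1, Complex.exp ((lam * P.eval t : ℝ) * Complex.I))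
      atTop (nhds 0) := by
  set Q := P.derivative
  have hpos : ∀ δ : ℝ, 0 < δ → ∀ t, 0 < Q.eval t ^ 2 + δ := fun δ hδ t => by positivity
  have hsmall : Tendsto (fun δ : ℝ => ∫ t in (0 : ℝ)..1, δ / (Q.eval t ^ 2 + δ))
      (nhdsWithin 0 (Set.Ioi 0)) (nhds 0) := by
    suffices h : Tendsto (fun δ : ℝ => ∫ t in (0 : ℝ)..1, δ / (Q.eval t ^ 2 + δ))
        (nhdsWithin 0 (Set.Ioi 0)) (nhds (∫ _ in (0 : ℝ)..1, (0 : ℝ))) by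
      rwa [intervalIntegral.integral_zero] at h
    refine intervalIntegral.tendsto_integral_filter_of_dominated_convergence (fun _ => 1) ?_ ?_
      intervalIntegrable_const ?_
    · filter_upwards [self_mem_nhdsWithin] with δ hδ
      exact (continuous_const.div (by fun_prop)
        fun t => (hpos δ hδ t).ne').aestronglyMeasurable
    · filter_upwards [self_mem_nhdsWithin] with δ hδ
      refine ae_of_all _ fun t _ => ?_
      have hδ' : (0 : ℝ) < δ := hδ
      rw [Real.norm_eq_abs, abs_of_nonneg (div_nonneg hδ'.le (hpos δ hδ t).le),
        div_le_one (hpos δ hδ t)]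
      nlinarith [sq_nonneg (Q.eval t)]
    · have hfin : {t : ℝ | Q.IsRoot t}.Finite := Polynomial.finite_setOfPred_isRoot hP
      filter_upwards [hfin.countable.ae_notMem volume] with t ht _
      have hQt : Q.eval t ≠ 0 := ht
      have hcont : ContinuousAt (fun δ : ℝ => δ / (Q.eval t ^ 2 + δ)) 0 :=
        continuousAt_id.div (by fun_prop) (by simpa using hQt)
      simpa using hcont.tendsto.mono_left nhdsWithin_le_nhds
  rw [Metric.tendsto_nhds]
  intro ε hε
  obtain ⟨δ, hδε, hδ⟩ := ((Metric.tendsto_nhds.mp hsmall (ε / 2) (by positivity)).and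
    self_mem_nhdsWithin).exists
  have hδ' : (0 : ℝ) < δ := hδ
  have hg : ∀ t, HasDerivAt (fun t => Q.eval t / (Q.eval t ^ 2 + δ))
      ((Q.derivative.eval t * (Q.eval t ^ 2 + δ) -
        Q.eval t * (2 * Q.eval t * Q.derivative.eval t)) / (Q.eval t ^ 2 + δ) ^ 2) t := by
    intro t
    convert! (Q.hasDerivAt t).div (((Q.hasDerivAt t).pow 2).add_const δ) (hpos δ hδ t).ne' using 1
    norm_num
  have hmain := tendsto_integral_deriv_mul_exp 0 1 P.hasDerivAt hg Q.continuous
    (Continuous.div (by fun_prop) (by fun_prop) fun t => (pow_pos (hpos δ hδ t) 2).ne')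
  filter_upwards [Metric.tendsto_nhds.mp hmain (ε / 2) (by positivity)] with lam hlam
  rw [dist_zero_right] at hlam hδε ⊢
  have hc : Continuous fun t => δ / (Q.eval t ^ 2 + δ) :=
    continuous_const.div (by fun_prop) fun t => (hpos δ hδ t).ne'
  have hc' : Continuous fun t => Q.eval t / (Q.eval t ^ 2 + δ) * Q.eval t :=
    (Continuous.div (by fun_prop) (by fun_prop) fun t => (hpos δ hδ t).ne').mul (by fun_prop)
  have hE : Continuous fun t => Complex.exp ((lam * P.eval t : ℝ) * Complex.I) := by fun_prop
  have hsplit : ∫ t in (0 : ℝ)..1, Complex.exp ((lam * P.eval t : ℝ) * Complex.I)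
      = (∫ t in (0 : ℝ)..1, ((Q.eval t / (Q.eval t ^ 2 + δ) * Q.eval t : ℝ) : ℂ) *
          Complex.exp ((lam * P.eval t : ℝ) * Complex.I))
        + ∫ t in (0 : ℝ)..1, ((δ / (Q.eval t ^ 2 + δ) : ℝ) : ℂ) *
          Complex.exp ((lam * P.eval t : ℝ) * Complex.I) := by
    refine Eq.trans ?_ (intervalIntegral.integral_add
      (((Complex.continuous_ofReal.comp hc').mul hE).intervalIntegrable _ _)
      (((Complex.continuous_ofReal.comp hc).mul hE).intervalIntegrable _ _))
    refine intervalIntegral.integral_congr fun t _ => ?_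
    change Complex.exp ((lam * P.eval t : ℝ) * Complex.I)
      = ((Q.eval t / (Q.eval t ^ 2 + δ) * Q.eval t : ℝ) : ℂ) *
          Complex.exp ((lam * P.eval t : ℝ) * Complex.I)
        + ((δ / (Q.eval t ^ 2 + δ) : ℝ) : ℂ) * Complex.exp ((lam * P.eval t : ℝ) * Complex.I)
    rw [← add_mul, ← Complex.ofReal_add]
    have : Q.eval t / (Q.eval t ^ 2 + δ) * Q.eval t + δ / (Q.eval t ^ 2 + δ) = 1 := by
      have := (hpos δ hδ t).ne'
      field_simp
    rw [this, Complex.ofReal_one, one_mul]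
  have herr : ‖∫ t in (0 : ℝ)..1, ((δ / (Q.eval t ^ 2 + δ) : ℝ) : ℂ) *
      Complex.exp ((lam * P.eval t : ℝ) * Complex.I)‖ < ε / 2 := by
    refine lt_of_le_of_lt ?_ hδε
    refine (intervalIntegral.norm_integral_le_abs_integral_norm).trans_eq ?_
    rw [Real.norm_eq_abs]
    congr 2
    ext t
    rw [norm_mul, Complex.norm_exp_ofReal_mul_I, Complex.norm_real, mul_one, Real.norm_eq_abs,
      abs_of_nonneg (div_nonneg hδ'.le (hpos δ hδ t).le)]
  rw [hsplit]
  refine (norm_add_le _ _).trans_lt ?_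
  linarith

/-- A nontrivial monomial on the torus has zero mean. -/
lemma integral_mFourier_of_ne_zero {n : ℕ} {ν : Fin n → ℤ} (hν : ν ≠ 0) :
    ∫ z : Fin n → AddCircle (1 : ℝ), UnitAddTorus.mFourier ν z = 0 := by
  obtain ⟨i, hi⟩ := Function.ne_iff.mp hν
  have hprod := integral_fintype_prod_volume_eq_prod
    (fun (i : Fin n) (x : AddCircle (1 : ℝ)) => (fourier (ν i) x : ℂ))
  refine hprod.trans (Finset.prod_eq_zero (Finset.mem_univ i) ?_)
  exact integral_eq_zero_of_add_right_eq_neg (fourier_add_half_inv_index hi one_pos)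

/-- Along a dilated polynomial curve, a monomial is an exponential with polynomial phase. -/
lemma mFourier_polynomial_curve {n d : ℕ} (A : Matrix (Fin n) (Fin d) ℝ) (ν : Fin n → ℤ)
    (lam t : ℝ) :
    UnitAddTorus.mFourier ν
        (fun j => ((lam * ∑ k : Fin d, A j k * t ^ ((k : ℕ) + 1) : ℝ) : AddCircle (1 : ℝ)))
      = Complex.exp ((2 * π * lam *
          (∑ k : Fin d, Polynomial.monomial ((k : ℕ) + 1)
            (Aᵀ.mulVec (fun j => (ν j : ℝ)) k)).eval t : ℝ) * Complex.I) := by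
  have heval : (∑ k : Fin d, Polynomial.monomial ((k : ℕ) + 1)
      (Aᵀ.mulVec (fun j => (ν j : ℝ)) k)).eval t
      = ∑ j, (ν j : ℝ) * ∑ k : Fin d, A j k * t ^ ((k : ℕ) + 1) := by
    simp_rw [Polynomial.eval_finsetSum, Polynomial.eval_monomial, Matrix.mulVec, dotProduct,
      Matrix.transpose_apply, Finset.sum_mul, Finset.mul_sum]
    rw [Finset.sum_comm]
    refine Finset.sum_congr rfl fun j _ => Finset.sum_congr rfl fun k _ => ?_
    ring
  change ∏ j, fourier (ν j)
    ((lam * ∑ k : Fin d, A j k * t ^ ((k : ℕ) + 1) : ℝ) : AddCircle (1 : ℝ)) = _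
  simp_rw [fourier_coe_apply]
  rw [← Complex.exp_sum, heval]
  congr 1
  push_cast
  rw [Finset.mul_sum, Finset.sum_mul]
  refine Finset.sum_congr rfl fun j _ => ?_
  ring

/-- The phase polynomial with coefficients `c` in degrees `1, …, d` is nonconstant if `c ≠ 0`. -/
lemma derivative_sum_monomial_ne_zero {d : ℕ} {c : Fin d → ℝ} (hc : c ≠ 0) :
    (∑ k : Fin d, Polynomial.monomial ((k : ℕ) + 1) (c k)).derivative ≠ 0 := by
  obtain ⟨k, hk⟩ := Function.ne_iff.mp hc
  intro h
  have hcoeff := congrArg (fun p : Polynomial ℝ => p.coeff k) h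
  simp only [Polynomial.coeff_derivative, Polynomial.finsetSum_coeff, Polynomial.coeff_monomial,
    add_left_inj, Fin.val_inj, Finset.sum_ite_eq', Finset.mem_univ, if_true,
    Polynomial.coeff_zero] at hcoeff
  exact (mul_ne_zero hk (by positivity)) hcoeff

/-- Let `p_j(t) = ∑_{k=1}^d a_{jk} t^k` (`d ≥ n`) have coefficient matrix `A` whose transpose has
trivial kernel over `ℝ`. Then the pushforward measures `μ_λ` of Lebesgue measure on `[0,1]`
under `t ↦ λp(t) mod ℤ^n` converge to the Haar probability measure `m` on `𝕋^n` as
pseudo-measures: for every continuous `f : 𝕋^n → ℂ` with absolutely summable Fourier series,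
`∫ f dμ_λ → ∫ f dm` as `λ → ∞`. -/
theorem convergence_as_pseudomeasures (n d : ℕ) (hnd : n ≤ d) (hd : 0 < d)
    (A : Matrix (Fin n) (Fin d) ℝ)
    (hker : ∀ x : Fin n → ℝ, x ≠ 0 → Aᵀ.mulVec x ≠ 0)
    (f : C((Fin n → AddCircle (1:ℝ)), ℂ))
    (hsum : Summable (fun ν : Fin n → ℤ =>
      ‖∫ z : Fin n → AddCircle (1:ℝ),
          f z * (starRingEnd ℂ) (∏ i, fourier (ν i) (z i)) ∂volume‖)) :
    Tendsto (fun lam : ℝ =>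
        ∫ t in (0:ℝ)..1,
          f (fun j => ((lam * ∑ k : Fin d, A j k * t ^ ((k : ℕ) + 1) : ℝ) : AddCircle (1:ℝ))))
      atTop (nhds (∫ z : Fin n → AddCircle (1:ℝ), f z ∂volume)) := by
  let γ : ℝ → ℝ → Fin n → AddCircle (1 : ℝ) := fun lam t j =>
    ((lam * ∑ k : Fin d, A j k * t ^ ((k : ℕ) + 1) : ℝ) : AddCircle (1 : ℝ))
  have hγ : ∀ lam, Continuous (γ lam) := fun lam => continuous_pi fun j =>
    (AddCircle.continuous_mk' 1).comp (by fun_prop)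
  let m : Measure ℝ := volume.restrict (Set.Ioc 0 1)
  have : IsProbabilityMeasure m := ⟨by simp [m]⟩
  have (lam : ℝ) : IsProbabilityMeasure (m.map (γ lam)) :=
    Measure.isProbabilityMeasure_map (hγ lam).aemeasurable
  have hmap : ∀ (g : C((Fin n → AddCircle (1 : ℝ)), ℂ)) (lam : ℝ),
      ∫ z, g z ∂(m.map (γ lam)) = ∫ t in (0 : ℝ)..1, g (γ lam t) := fun g lam => by
    rw [integral_map (hγ lam).aemeasurable g.continuous.aestronglyMeasurable,
      intervalIntegral.integral_of_le zero_le_one]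
  have : IsProbabilityMeasure (volume : Measure (AddCircle (1 : ℝ))) := ⟨by simp⟩
  suffices h : Tendsto (fun lam => ∫ z, f z ∂(m.map (γ lam))) atTop
      (nhds (∫ z : Fin n → AddCircle (1 : ℝ), f z)) by
    simpa only [hmap] using h
  refine tendsto_integral_of_span_dense UnitAddTorus.span_mFourier_closure_eq_top ?_ f
  rintro _ ⟨ν, rfl⟩
  rcases eq_or_ne ν 0 with rfl | hν
  · simp [UnitAddTorus.mFourier_zero]
  rw [integral_mFourier_of_ne_zero hν]
  have hν' : (fun j => (ν j : ℝ)) ≠ 0 := fun h =>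
    hν (funext fun j => Int.cast_eq_zero.mp (congrFun h j))
  have hosc := tendsto_integral_exp_polynomial _
    (derivative_sum_monomial_ne_zero (hker _ hν'))
  refine (hosc.comp (tendsto_id.const_mul_atTop two_pi_pos)).congr fun lam => ?_
  rw [hmap]
  exact (intervalIntegral.integral_congr fun t _ => mFourier_polynomial_curve A ν lam t).symm
end

section
/- Let a, b : ℝ → ℝ^n be polynomial curves, let c : ℝ → ℝ be a polynomial with c(0) = 0 and c'(t) > 0 for all t ∈ (0,1], let m be a nonzero integer, and let G : ℝ^n × ℝ^n → ℂ be a bounded continuously differentiable function with bounded derivative. Then ∫₀¹ e^{2πi m λ c(t)} G(λ^{1/2} a(t), λ^{1/2} b(t)) dt → 0 as λ → ∞. -/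
open MeasureTheory Filter Real

/-- First-derivative estimate for oscillatory integrals: one integration by parts bounds
`∫ e^{iKc} g` by a multiple of `1 / |K|` when the phase derivative `c'` stays above `δ > 0`. -/
theorem norm_integral_exp_mul_le {x y δ C M N K : ℝ} (hxy : x ≤ y) (hδ : 0 < δ)
    (hK : K ≠ 0) {c c' c'' : ℝ → ℝ} {g g' : ℝ → ℂ}
    (hc : ∀ t, HasDerivAt c (c' t) t) (hc' : ∀ t, HasDerivAt c' (c'' t) t)
    (hc'' : Continuous c'') (hg : ∀ t, HasDerivAt g (g' t) t) (hg' : Continuous g')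
    (hcδ : ∀ t ∈ Set.Icc x y, δ ≤ c' t) (hC : ∀ t ∈ Set.Icc x y, |c'' t| ≤ C)
    (hM : ∀ t, ‖g t‖ ≤ M) (hN : ∀ t ∈ Set.Icc x y, ‖g' t‖ ≤ N) :
    ‖∫ t in x..y, Complex.exp (Complex.I * ((K * c t : ℝ) : ℂ)) * g t‖ ≤
      (2 * (M / δ) + (N / δ + M * C / δ ^ 2) * (y - x)) / |K| := by
  have hM0 : 0 ≤ M := (norm_nonneg _).trans (hM x)
  have hcc : Continuous c := continuous_iff_continuousAt.2 fun t => (hc t).continuousAt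
  have hcc' : Continuous c' := continuous_iff_continuousAt.2 fun t => (hc' t).continuousAt
  have hgc : Continuous g := continuous_iff_continuousAt.2 fun t => (hg t).continuousAt
  set E : ℝ → ℂ := fun t => Complex.exp (Complex.I * ((K * c t : ℝ) : ℂ)) with hE
  have hEnorm : ∀ t, ‖E t‖ = 1 := fun t => by
    simp only [hE]; rw [mul_comm]; exact Complex.norm_exp_ofReal_mul_I _
  have hEc : Continuous E := by fun_prop
  have hpos : ∀ t ∈ Set.Icc x y, 0 < c' t := fun t ht => hδ.trans_le (hcδ t ht)
  have hne : ∀ t ∈ Set.Icc x y, (c' t : ℂ) ≠ 0 := fun t ht =>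
    Complex.ofReal_ne_zero.2 (hpos t ht).ne'
  have hKC : Complex.I * (K : ℂ) ≠ 0 :=
    mul_ne_zero Complex.I_ne_zero (Complex.ofReal_ne_zero.2 hK)
  have hEd : ∀ t, HasDerivAt E (Complex.I * K * c' t * E t) t := fun t => by
    have h := ((((hc t).const_mul K).ofReal_comp).const_mul Complex.I).cexp
    convert h using 1
    simp only [hE]; push_cast; ring
  set u : ℝ → ℂ := fun t => g t / c' t with hu
  set u' : ℝ → ℂ := fun t => (g' t * c' t - g t * c'' t) / (c' t : ℂ) ^ 2 with hu'
  have hud : ∀ t ∈ Set.Icc x y, HasDerivAt u (u' t) t := fun t ht =>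
    (hg t).div (hc' t).ofReal_comp (hne t ht)
  have hu'c : ContinuousOn u' (Set.uIcc x y) := by
    rw [Set.uIcc_of_le hxy]
    refine ContinuousOn.div (by fun_prop) (by fun_prop) fun t ht => pow_ne_zero 2 (hne t ht)
  have hunorm : ∀ t ∈ Set.Icc x y, ‖u t‖ ≤ M / δ := fun t ht => by
    simp only [hu, norm_div, Complex.norm_real, Real.norm_eq_abs, abs_of_pos (hpos t ht)]
    exact div_le_div₀ hM0 (hM t) hδ (hcδ t ht)
  have hu'norm : ∀ t ∈ Set.Icc x y, ‖u' t‖ ≤ N / δ + M * C / δ ^ 2 := fun t ht => by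
    have h1 : u' t = g' t / c' t - g t * c'' t / (c' t : ℂ) ^ 2 := by
      have := hne t ht
      simp only [hu']; field_simp
    rw [h1]
    refine (norm_sub_le _ _).trans (add_le_add ?_ ?_)
    · simp only [norm_div, Complex.norm_real, Real.norm_eq_abs, abs_of_pos (hpos t ht)]
      exact div_le_div₀ ((norm_nonneg _).trans (hN t ht)) (hN t ht) hδ (hcδ t ht)
    · simp only [norm_div, norm_mul, norm_pow, Complex.norm_real, Real.norm_eq_abs,
        abs_of_pos (hpos t ht)]
      have hC0 := (abs_nonneg _).trans (hC t ht)
      exact div_le_div₀ (mul_nonneg hM0 hC0)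
        (mul_le_mul (hM t) (hC t ht) (abs_nonneg _) hM0) (by positivity)
        (pow_le_pow_left₀ hδ.le (hcδ t ht) 2)
  have parts := intervalIntegral.integral_mul_deriv_eq_deriv_mul (a := x) (b := y)
    (u := u) (u' := u') (v := E) (v' := fun t => Complex.I * K * c' t * E t)
    (fun t ht => hud t (by rwa [Set.uIcc_of_le hxy] at ht)) (fun t _ => hEd t)
    hu'c.intervalIntegrable
    (Continuous.intervalIntegrable (by fun_prop) _ _)
  have hrew : ∫ t in x..y, u t * (Complex.I * K * c' t * E t) =
      Complex.I * K * ∫ t in x..y, E t * g t := by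
    rw [← intervalIntegral.integral_const_mul]
    refine intervalIntegral.integral_congr fun t ht => ?_
    rw [Set.uIcc_of_le hxy] at ht
    have := hne t ht
    simp only [hu]; field_simp
  have hint : ‖∫ t in x..y, u' t * E t‖ ≤ (N / δ + M * C / δ ^ 2) * (y - x) := by
    have := intervalIntegral.norm_integral_le_of_norm_le_const (a := x) (b := y)
      (f := fun t => u' t * E t) (C := N / δ + M * C / δ ^ 2) fun t ht => by
        rw [Set.uIoc_of_le hxy] at ht
        rw [norm_mul, hEnorm, mul_one]
        exact hu'norm t (Set.Ioc_subset_Icc_self ht)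
    rwa [abs_of_nonneg (sub_nonneg.2 hxy)] at this
  have hEu : ∀ t ∈ Set.Icc x y, ‖u t * E t‖ ≤ M / δ := fun t ht => by
    rw [norm_mul, hEnorm, mul_one]; exact hunorm t ht
  rw [le_div_iff₀ (abs_pos.2 hK)]
  calc ‖∫ t in x..y, E t * g t‖ * |K|
      = ‖Complex.I * K * ∫ t in x..y, E t * g t‖ := by
        simp [mul_comm]
    _ = ‖u y * E y - u x * E x - ∫ t in x..y, u' t * E t‖ := by rw [← hrew, parts]
    _ ≤ ‖u y * E y‖ + ‖u x * E x‖ + ‖∫ t in x..y, u' t * E t‖ :=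
        (norm_sub_le _ _).trans (by gcongr; exact norm_sub_le _ _)
    _ ≤ M / δ + M / δ + (N / δ + M * C / δ ^ 2) * (y - x) :=
        add_le_add (add_le_add (hEu y ⟨hxy, le_rfl⟩) (hEu x ⟨le_rfl, hxy⟩)) hint
    _ = _ := by ring

/-- Key oscillatory estimate for equidistribution on Heisenberg nilmanifolds: if `a, b` are
polynomial curves in `ℝ^n`, `c` is a real polynomial with `c(0) = 0` and `c'(t) > 0` on
`(0,1]`, `m` is a nonzero integer, and `G : ℝ^n × ℝ^n → ℂ` is a bounded `C¹` function with
bounded derivative, then `∫₀¹ e^{2πimλc(t)} G(λ^{1/2}a(t), λ^{1/2}b(t)) dt → 0` as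
`λ → ∞`. -/
theorem heisenberg_oscillatory_integral
    {n : ℕ} (a b : Fin n → Polynomial ℝ) (c : Polynomial ℝ)
    (hc0 : c.eval 0 = 0)
    (hc' : ∀ t ∈ Set.Ioc (0:ℝ) 1, 0 < (Polynomial.derivative c).eval t)
    (m : ℤ) (hm : m ≠ 0)
    (G : ((Fin n → ℝ) × (Fin n → ℝ)) → ℂ)
    (hG : ContDiff ℝ 1 G)
    (hGbdd : ∃ M : ℝ, ∀ x, ‖G x‖ ≤ M)
    (hG'bdd : ∃ M : ℝ, ∀ x, ‖fderiv ℝ G x‖ ≤ M) :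
    Tendsto (fun lam : ℝ =>
        ∫ t in (0:ℝ)..1,
          Complex.exp (2 * π * Complex.I * (((m : ℝ) * (lam * c.eval t) : ℝ) : ℂ)) *
            G (fun i => Real.sqrt lam * (a i).eval t, fun i => Real.sqrt lam * (b i).eval t))
      atTop (nhds 0) := by
  obtain ⟨M, hM⟩ := hGbdd
  obtain ⟨D, hD⟩ := hG'bdd
  have hM0 : 0 ≤ M := (norm_nonneg _).trans (hM 0)
  have hD0 : 0 ≤ D := (norm_nonneg _).trans (hD 0)
  set p : ℝ → (Fin n → ℝ) × (Fin n → ℝ) :=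
    fun t => (fun i => (a i).eval t, fun i => (b i).eval t) with hp
  set p' : ℝ → (Fin n → ℝ) × (Fin n → ℝ) :=
    fun t => (fun i => (a i).derivative.eval t, fun i => (b i).derivative.eval t) with hp'
  have hpd : ∀ t, HasDerivAt p (p' t) t := fun t =>
    (hasDerivAt_pi.2 fun i => (a i).hasDerivAt t).prodMk
      (hasDerivAt_pi.2 fun i => (b i).hasDerivAt t)
  have hpc : Continuous p := continuous_iff_continuousAt.2 fun t => (hpd t).continuousAt
  have hp'c : Continuous p' := by fun_prop
  obtain ⟨P, hP⟩ := isCompact_Icc.exists_bound_of_continuousOn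
    (s := Set.Icc (0 : ℝ) 1) hp'c.continuousOn
  obtain ⟨C, hC⟩ := isCompact_Icc.exists_bound_of_continuousOn
    (s := Set.Icc (0 : ℝ) 1) (c.derivative.derivative.continuous).continuousOn
  set g : ℝ → ℝ → ℂ := fun lam t => G (Real.sqrt lam • p t) with hg
  have hgd : ∀ lam t, HasDerivAt (g lam)
      (fderiv ℝ G (Real.sqrt lam • p t) (Real.sqrt lam • p' t)) t := fun lam t =>
    ((hG.differentiable one_ne_zero) _).hasFDerivAt.comp_hasDerivAt t
      ((hpd t).const_smul (Real.sqrt lam))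
  have hg'c : ∀ lam, Continuous fun t =>
      fderiv ℝ G (Real.sqrt lam • p t) (Real.sqrt lam • p' t) := fun lam => by
    have := hG.continuous_fderiv one_ne_zero
    fun_prop
  have hg'norm : ∀ lam, ∀ t ∈ Set.Icc (0 : ℝ) 1,
      ‖fderiv ℝ G (Real.sqrt lam • p t) (Real.sqrt lam • p' t)‖ ≤ D * P * Real.sqrt lam := by
    intro lam t ht
    calc _ ≤ ‖fderiv ℝ G (Real.sqrt lam • p t)‖ * ‖Real.sqrt lam • p' t‖ :=
          ContinuousLinearMap.le_opNorm _ _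
      _ ≤ D * (Real.sqrt lam * P) := by
          rw [norm_smul, Real.norm_of_nonneg (Real.sqrt_nonneg _)]
          exact mul_le_mul (hD _) (mul_le_mul_of_nonneg_left (hP t ht) (Real.sqrt_nonneg _))
            (by positivity) hD0
      _ = _ := by ring
  set κ : ℝ := 2 * π * m with hκ
  have hκ0 : κ ≠ 0 := mul_ne_zero (by positivity) (Int.cast_ne_zero.2 hm)
  set f : ℝ → ℝ → ℂ := fun lam t =>
    Complex.exp (Complex.I * ((κ * lam * c.eval t : ℝ) : ℂ)) * g lam t with hf
  have hfc : ∀ lam, Continuous (f lam) := fun lam => by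
    have hgc : Continuous (g lam) :=
      continuous_iff_continuousAt.2 fun t => (hgd lam t).continuousAt
    have := c.continuous
    fun_prop
  have hfnorm : ∀ lam t, ‖f lam t‖ ≤ M := fun lam t => by
    simp only [hf]
    rw [norm_mul, mul_comm Complex.I, Complex.norm_exp_ofReal_mul_I, one_mul]
    exact hM _
  suffices h : Tendsto (fun lam => ∫ t in (0 : ℝ)..1, f lam t) atTop (nhds 0) by
    refine h.congr fun lam => intervalIntegral.integral_congr fun t _ => ?_
    simp only [hf, hg, hκ]
    congr 2
    push_cast; ring
  rw [Metric.tendsto_atTop']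
  intro η hη
  simp only [dist_zero_right, gt_iff_lt]
  set ε : ℝ := min 1 (η / (2 * (M + 1))) with hε
  have hε0 : 0 < ε := lt_min one_pos (by positivity)
  have hε1 : ε ≤ 1 := min_le_left _ _
  have hMε : M * ε ≤ η / 2 := by
    have h1 : ε ≤ η / (2 * (M + 1)) := min_le_right _ _
    rw [le_div_iff₀ (by positivity)] at h1
    nlinarith
  have hsub : Set.Icc ε 1 ⊆ Set.Icc 0 1 := Set.Icc_subset_Icc_left hε0.le
  obtain ⟨s, hs, hmin⟩ := isCompact_Icc.exists_isMinOn (Set.nonempty_Icc.2 hε1)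
    (c.derivative.continuous.continuousOn (s := Set.Icc ε 1))
  set δ : ℝ := c.derivative.eval s
  have hδ : 0 < δ := hc' s ⟨hε0.trans_le hs.1, hs.2⟩
  have hbound : ∀ lam > 0, ‖∫ t in ε..1, f lam t‖ ≤
      (2 * (M / δ) + (D * P * Real.sqrt lam / δ + M * C / δ ^ 2) * (1 - ε)) / |κ * lam| :=
    fun lam hlam => norm_integral_exp_mul_le hε1 hδ (mul_ne_zero hκ0 hlam.ne')
      (fun t => c.hasDerivAt t) (fun t => c.derivative.hasDerivAt t)
      c.derivative.derivative.continuous (hgd lam) (hg'c lam) (fun t ht => hmin ht)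
      (fun t ht => hC t (hsub ht)) (fun t => hM _) (fun t ht => hg'norm lam t (hsub ht))
  have hlim : Tendsto (fun lam : ℝ =>
      (2 * (M / δ) + M * C / δ ^ 2 * (1 - ε)) / |κ| * lam⁻¹ +
        D * P / δ * (1 - ε) / |κ| * (Real.sqrt lam)⁻¹) atTop (nhds 0) := by
    simpa using (tendsto_inv_atTop_zero.const_mul _).add
      ((tendsto_inv_atTop_zero.comp Real.tendsto_sqrt_atTop).const_mul _)
  obtain ⟨L, hL⟩ := eventually_atTop.1 (hlim.eventually_lt_const (half_pos hη))
  refine ⟨max L 0, fun lam hlam => ?_⟩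
  have hlam0 : 0 < lam := (le_max_right _ _).trans_lt hlam
  have hsmall := hL lam ((le_max_left _ _).trans hlam.le)
  have hhead : ‖∫ t in (0 : ℝ)..ε, f lam t‖ ≤ M * ε := by
    simpa [abs_of_pos hε0] using
      intervalIntegral.norm_integral_le_of_norm_le_const (a := 0) (b := ε)
        fun t _ => hfnorm lam t
  have htail : ‖∫ t in ε..1, f lam t‖ < η / 2 := by
    refine (hbound lam hlam0).trans_lt (lt_of_eq_of_lt ?_ hsmall)
    rw [abs_mul, abs_of_pos hlam0]
    have hκa : |κ| ≠ 0 := abs_ne_zero.2 hκ0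
    have hsq : Real.sqrt lam ≠ 0 := (Real.sqrt_pos.2 hlam0).ne'
    have hss : lam = Real.sqrt lam * Real.sqrt lam := (Real.mul_self_sqrt hlam0.le).symm
    generalize Real.sqrt lam = r at *
    subst hss
    field_simp
    ring
  rw [← intervalIntegral.integral_add_adjacent_intervals
    ((hfc lam).intervalIntegrable 0 ε) ((hfc lam).intervalIntegrable ε 1)]
  exact (norm_add_le _ _).trans_lt (by linarith)
end
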